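/- arXiv:1405.1888 — 6 statements merged into one kernel-verified Lean document; each statement's English description precedes it below -/
import Mathlib

section
/- Let 𝒜 be a Grothendieck abelian category, and fix a ring R together with an adjoint pair of additive functors F : Mod R → 𝒜 and G : 𝒜 → Mod R (F left adjoint to G) such that F is exact and the counit F ∘ G ≅ id is an isomorphism. Let μ be an infinite cardinal with μ ≥ |R|. Then for every regular cardinal λ > μ and every R-module N whose underlying set has cardinality < λ, the object F N is λ-presentable in 𝒜. -/
open CategoryTheory Limits Opposite

universe v u

/-- A small category `J` is `κ`-filtered if every functor to `J` from a small category with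
fewer than `κ` arrows admits a cocone. -/
def IsCardinalFiltered (J : Type v) [SmallCategory J] (κ : Cardinal.{v}) : Prop :=
  ∀ (K : Type v) [SmallCategory K], Cardinal.mk (Arrow K) < κ →
    ∀ (F : K ⥤ J), Nonempty (Cocone F)

/-- An object `a` of a category is `κ`-presentable if the functor `Hom(a, -)`
preserves colimits indexed by `κ`-filtered categories. -/
def IsPresentable {𝒜 : Type u} [Category.{v} 𝒜] (κ : Cardinal.{v}) (a : 𝒜) : Prop :=
  ∀ (J : Type v) [SmallCategory J], IsCardinalFiltered J κ →
    Nonempty (PreservesColimitsOfShape J (coyoneda.obj (op a)))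

namespace CategoryTheory

section

variable {C : Type*} [Category* C] {D : Type*} [Category* D] {F : C ⥤ D} {G : D ⥤ C}

lemma Adjunction.exists_fac_of_isIso_map (adj : F ⊣ G) {A B : C} (i : A ⟶ B) [IsIso (F.map i)]
    {Y : D} (s : A ⟶ G.obj Y) : ∃ s' : B ⟶ G.obj Y, i ≫ s' = s :=
  ⟨adj.homEquiv _ _ (inv (F.map i) ≫ (adj.homEquiv _ _).symm s), by
    rw [← adj.homEquiv_naturality_left, IsIso.hom_inv_id_assoc, Equiv.apply_symm_apply]⟩

lemma Adjunction.cancel_of_epi_map (adj : F ⊣ G) {A B : C} (i : A ⟶ B) [Epi (F.map i)]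
    {Y : D} {s t : B ⟶ G.obj Y} (h : i ≫ s = i ≫ t) : s = t := by
  apply (adj.homEquiv _ _).symm.injective
  rw [← cancel_epi (F.map i), ← adj.homEquiv_naturality_left_symm,
    ← adj.homEquiv_naturality_left_symm, h]

lemma Adjunction.isIso_map_unit_app (adj : F ⊣ G) [IsIso adj.counit] (X : C) :
    IsIso (F.map (adj.unit.app X)) := by
  have : IsIso (F.map (adj.unit.app X) ≫ adj.counit.app (F.obj X)) := by
    simpa using IsIso.id _
  exact IsIso.of_isIso_comp_right _ (adj.counit.app (F.obj X))

lemma Adjunction.isIso_unit_app_obj (adj : F ⊣ G) [IsIso adj.counit] (Y : D) :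
    IsIso (adj.unit.app (G.obj Y)) := by
  have : IsIso (adj.unit.app (G.obj Y) ≫ G.map (adj.counit.app Y)) := by
    simpa using IsIso.id _
  exact IsIso.of_isIso_comp_right _ (G.map (adj.counit.app Y))

end

lemma IsSeparator.isZero_of_forall_eq_zero {C : Type*} [Category* C] [HasZeroMorphisms C]
    {P : C} (hP : IsSeparator P) {X : C} (h : ∀ f : P ⟶ X, f = 0) : IsZero X := by
  rw [IsZero.iff_id_eq_zero]
  exact (isSeparator_def P).1 hP _ _ fun f ↦ by simp [h f]

section

universe w

variable {C : Type*} [Category* C] [Abelian C] {D : Type*} [Category* D] [Abelian D]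
  {F : C ⥤ D} {G : D ⥤ C}

lemma isIso_map_kernel_ι_of_isZero [F.PreservesZeroMorphisms] [PreservesFiniteLimits F]
    {A B : C} (f : A ⟶ B) (hB : IsZero (F.obj B)) : IsIso (F.map (kernel.ι f)) := by
  have : IsIso (kernel.ι (F.map f)) :=
    kernel.ι_of_zero (hB.eq_of_tgt _ _)
  exact IsIso.of_isIso_fac_left (PreservesKernel.iso_inv_ι F f)

variable {κ : Cardinal.{w}} [Fact κ.IsRegular]

/-- Let `F ⊣ G` exhibit `D` as an exact localization of `C`, and assume that `C` has a separator
all of whose subobjects are `κ`-presentable. Then `κ`-filtered colimits in `C` of objects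
in the image of `G` are local. -/
lemma Adjunction.isIso_unit_app_of_isColimit (adj : F ⊣ G) [IsIso adj.counit]
    [F.PreservesZeroMorphisms] [PreservesFiniteLimits F]
    {P : C} (hP : IsSeparator P)
    (hP' : ∀ ⦃K : C⦄ (i : K ⟶ P) [Mono i], IsCardinalPresentable K κ)
    {J : Type w} [SmallCategory J] [CategoryTheory.IsCardinalFiltered J κ]
    {K : J ⥤ D} {c : Cocone (K ⋙ G)} (hc : IsColimit c) :
    IsIso (adj.unit.app c.pt) := by
  have := adj.isLeftAdjoint
  have := hP' (𝟙 P)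
  have := adj.isIso_map_unit_app c.pt
  have : Mono (adj.unit.app c.pt) := by
    refine Preadditive.mono_of_isZero_kernel _ (hP.isZero_of_forall_eq_zero fun f ↦ ?_)
    have hz : IsZero (F.obj (kernel (adj.unit.app c.pt))) := by
      rw [IsZero.iff_id_eq_zero, ← cancel_mono (F.map (kernel.ι (adj.unit.app c.pt))),
        ← cancel_mono (F.map (adj.unit.app c.pt)), Category.assoc, Category.assoc, ← F.map_comp]
      simp
    have := isIso_map_kernel_ι_of_isZero f hz
    have := hP' (kernel.ι f)
    obtain ⟨j, p, hp⟩ := IsCardinalPresentable.exists_hom_of_isColimit κ hc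
      (f ≫ kernel.ι (adj.unit.app c.pt))
    obtain ⟨k, u, hk⟩ := IsCardinalPresentable.exists_eq_of_isColimit' κ hc
      (kernel.ι f ≫ p) 0 (by simp [hp])
    have : p ≫ (K ⋙ G).map u = 0 :=
      adj.cancel_of_epi_map (kernel.ι f) (by simpa using hk)
    rw [← cancel_mono (kernel.ι (adj.unit.app c.pt)), ← hp, ← c.w u, ← Category.assoc, this]
    simp
  have : Epi (adj.unit.app c.pt) := by
    have hz : IsZero (F.obj (cokernel (adj.unit.app c.pt))) := by
      rw [IsZero.iff_id_eq_zero, ← cancel_epi (F.map (cokernel.π (adj.unit.app c.pt))),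
        ← cancel_epi (F.map (adj.unit.app c.pt)), ← Category.assoc, ← F.map_comp]
      simp
    refine Preadditive.epi_of_cokernel_zero ((isSeparator_def P).1 hP _ _ fun f ↦ ?_)
    let i := kernel.ι (f ≫ cokernel.π (adj.unit.app c.pt))
    have : IsIso (F.map i) := isIso_map_kernel_ι_of_isZero _ hz
    have := hP' i
    obtain ⟨t, ht⟩ : ∃ t, t ≫ adj.unit.app c.pt = i ≫ f :=
      ⟨_, Abelian.monoLift_comp (adj.unit.app c.pt) (i ≫ f) (by simp [i])⟩
    obtain ⟨j, s, hs⟩ := IsCardinalPresentable.exists_hom_of_isColimit κ hc t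
    obtain ⟨s', rfl⟩ := adj.exists_fac_of_isIso_map i (Y := K.obj j) s
    have : s' ≫ c.ι.app j ≫ adj.unit.app c.pt = f :=
      adj.cancel_of_epi_map i (by simpa [← hs] using ht)
    simp [← this]
  exact isIso_of_mono_of_epi _

/-- Let `F ⊣ G` exhibit `D` as an exact localization of `C`, and assume that `C` has a separator
all of whose subobjects are `κ`-presentable. Then the right adjoint `G` is `κ`-accessible. -/
lemma Adjunction.isCardinalAccessible_of_isSeparator (adj : F ⊣ G) [IsIso adj.counit]
    [F.PreservesZeroMorphisms] [PreservesFiniteLimits F] [HasCardinalFilteredColimits C κ]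
    {P : C} (hP : IsSeparator P)
    (hP' : ∀ ⦃K : C⦄ (i : K ⟶ P) [Mono i], IsCardinalPresentable K κ) :
    G.IsCardinalAccessible κ where
  preservesColimitOfShape J _ _ := ⟨fun {K} ↦ ⟨fun {d} hd ↦ by
    have : PreservesColimitsOfSize.{w, w} F := adj.leftAdjoint_preservesColimits
    have : PreservesColimitsOfSize.{w, w} (G ⋙ F) :=
      preservesColimits_of_natIso (asIso adj.counit).symm
    have := HasCardinalFilteredColimits.hasColimitsOfShape C κ J
    let hc := colimit.isColimit (K ⋙ G)
    let φ := hc.descCoconeMorphism (G.mapCocone d)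
    have := adj.isIso_unit_app_of_isColimit hP hP' hc
    have : IsIso (adj.unit.app (G.obj d.pt)) := adj.isIso_unit_app_obj d.pt
    have : IsIso ((Cocone.functoriality _ F).map φ) :=
      IsColimit.hom_isIso (isColimitOfPreserves F hc) (isColimitOfPreserves (G ⋙ F) hd) _
    have : IsIso (F.map φ.hom) :=
      inferInstanceAs (IsIso ((Cocone.forget _).map ((Cocone.functoriality _ F).map φ)))
    have : IsIso φ.hom := by
      have h : φ.hom ≫ adj.unit.app (G.obj d.pt) = adj.unit.app _ ≫ G.map (F.map φ.hom) :=
        adj.unit.naturality φ.hom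
      exact IsIso.of_isIso_fac_right h
    exact ⟨IsColimit.ofPointIso hc (i := this)⟩⟩⟩

end

end CategoryTheory

lemma Finsupp.mk_lt_of_lt {α β : Type u} [Zero β] {κ : Cardinal.{u}}
    (hκ : Cardinal.aleph0 < κ) (hα : Cardinal.mk α < κ) (hβ : Cardinal.mk β < κ) :
    Cardinal.mk (α →₀ β) < κ := by
  classical
  refine (Cardinal.mk_le_of_injective (Finsupp.graph_injective α β)).trans_lt ?_
  refine (Cardinal.mk_le_of_surjective (List.toFinset_surjective (α := α × β))).trans_lt ?_
  refine (Cardinal.mk_list_le_max _).trans_lt (max_lt hκ ?_)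
  rw [Cardinal.mk_prod, Cardinal.lift_id, Cardinal.lift_id]
  exact Cardinal.mul_lt_of_lt hκ.le hα hβ

namespace ModuleCat

universe w

variable {R : Type w} [Ring R] {κ : Cardinal.{w}} [Fact κ.IsRegular]

instance : (forget (ModuleCat.{w} R)).IsCardinalAccessible κ where
  preservesColimitOfShape J _ _ := by
    have := isFiltered_of_isCardinalFiltered J κ
    infer_instance

lemma isCardinalPresentable_free_obj {S : Type w} (hS : HasCardinalLT S κ) :
    IsCardinalPresentable ((free R).obj S) κ := by
  have : IsCardinalPresentable S κ := hS.isCardinalPresentable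
  exact (adj R).isCardinalPresentable_leftAdjoint_obj κ S

/-- Over a ring of cardinality `< κ`, with `κ` regular and uncountable, any module of
cardinality `< κ` is `κ`-presentable. -/
lemma isCardinalPresentable_of_mk_lt (hκ : Cardinal.aleph0 < κ) (hR : Cardinal.mk R < κ)
    (M : ModuleCat.{w} R) (hM : Cardinal.mk M < κ) : IsCardinalPresentable M κ := by
  let p := (adj R).counit.app M
  let q := (adj R).counit.app (kernel p)
  have : Epi p := inferInstance
  have : Epi q := inferInstance
  have hK : Cardinal.mk (kernel p : ModuleCat R) < κ :=
    (Cardinal.mk_le_of_injective ((mono_iff_injective (kernel.ι p)).1 inferInstance)).trans_lt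
      (Finsupp.mk_lt_of_lt hκ hM hR)
  have hc : IsColimit (CokernelCofork.ofπ p (f := q ≫ kernel.ι p) (by simp)) :=
    isCokernelEpiComp (Abelian.epiIsCokernelOfKernel _ (kernelIsKernel p)) q rfl
  have (k : WalkingParallelPair) :
      IsCardinalPresentable ((parallelPair (q ≫ kernel.ι p) 0).obj k) κ := by
    obtain _ | _ := k
    · exact isCardinalPresentable_free_obj ((hasCardinalLT_iff_cardinal_mk_lt _ _).2 hK)
    · exact isCardinalPresentable_free_obj ((hasCardinalLT_iff_cardinal_mk_lt _ _).2 hM)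
  exact isCardinalPresentable_of_isColimit' _ hc κ (hasCardinalLT_of_finite _ _ hκ.le)

end ModuleCat

/-- Let `𝒜` be a Grothendieck abelian category (abelian, with all small colimits, AB5 and
a separator), `R` a ring, `F ⊣ G` an adjoint pair of additive functors with `F` exact and
the counit `F ∘ G ≅ id` an isomorphism (as provided by the Gabriel–Popescu theorem).
If `μ` is an infinite cardinal with `μ ≥ |R|`, `λ > μ` is regular and `N` is an `R`-module
of cardinality `< λ`, then `F N` is a `λ`-presentable object of `𝒜`. -/
theorem stmt_0 {𝒜 : Type u} [Category.{v} 𝒜] [Abelian 𝒜] [HasColimits 𝒜] [AB5 𝒜]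
    [HasSeparator 𝒜]
    (R : Type v) [Ring R]
    (F : ModuleCat.{v} R ⥤ 𝒜) (G : 𝒜 ⥤ ModuleCat.{v} R)
    [F.Additive] [G.Additive]
    (adj : F ⊣ G)
    [PreservesFiniteLimits F] [PreservesFiniteColimits F]
    (hcounit : IsIso adj.counit)
    (μ : Cardinal.{v}) (hμ : Cardinal.aleph0 ≤ μ) (hR : Cardinal.mk R ≤ μ)
    (lam : Cardinal.{v}) (hreg : lam.IsRegular) (hlam : μ < lam)
    (N : ModuleCat.{v} R) (hN : Cardinal.mk (N : Type v) < lam) :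
    IsPresentable lam (F.obj N) := by
  have : Fact lam.IsRegular := ⟨hreg⟩
  have hlam₀ : Cardinal.aleph0 < lam := hμ.trans_lt hlam
  have hRlam : Cardinal.mk R < lam := hR.trans_lt hlam
  have := ModuleCat.isCardinalPresentable_of_mk_lt hlam₀ hRlam N hN
  have : G.IsCardinalAccessible lam :=
    adj.isCardinalAccessible_of_isSeparator (ModuleCat.isSeparator.{v} R) fun K i _ ↦
      ModuleCat.isCardinalPresentable_of_mk_lt hlam₀ hRlam K <|
        (Cardinal.mk_le_of_injective ((equivShrink R).symm.injective.comp
          ((ModuleCat.mono_iff_injective i).1 inferInstance))).trans_lt hRlam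
  have := adj.isCardinalPresentable_leftAdjoint_obj lam N
  intro J _ hJ
  have : CategoryTheory.IsCardinalFiltered J lam :=
    ⟨fun {A} _ E hA ↦ hJ A ((hasCardinalLT_iff_cardinal_mk_lt _ _).1 hA) E⟩
  exact ⟨preservesColimitsOfShape_of_isCardinalPresentable (F.obj N) lam J⟩
end

section
/- Let 𝒜 be a Grothendieck abelian category, and fix a ring R together with an adjoint pair of additive functors F : Mod R → 𝒜 and G : 𝒜 → Mod R (F left adjoint to G) such that F is exact and the counit F ∘ G ≅ id is an isomorphism. Let μ be an infinite cardinal with μ ≥ |R|. Then for every regular cardinal λ > μ, every λ-presentable object a of 𝒜 is isomorphic to F N for some R-module N whose underlying set has cardinality < λ; moreover one may take N to be a submodule of G a. -/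
open CategoryTheory Limits Opposite

universe v u

open Cardinal in
theorem Submodule.mk_span_lt {R M : Type v} [Ring R] [AddCommGroup M] [Module R M]
    {c : Cardinal.{v}} (hc : ℵ₀ < c) (hR : #R < c) (s : Set M) (hs : #s < c) :
    #(Submodule.span R s) < c := by
  have hfin : #(s →₀ R) ≤ #(Finset (s × R)) :=
    mk_le_of_injective (Finsupp.graph_injective s R)
  have hsurj : #(Submodule.span R s) ≤ #(s →₀ R) := by
    rw [Finsupp.span_eq_range_linearCombination]
    exact mk_le_of_surjective (LinearMap.surjective_rangeRestrict _)
  refine (hsurj.trans hfin).trans_lt ?_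
  rcases finite_or_infinite (s × R) with h | h
  · exact (lt_aleph0_of_finite _).trans hc
  · rw [mk_finset_of_infinite, mk_prod, lift_id, lift_id]
    exact mul_lt_of_lt hc.le hs hR

/-- The poset of submodules of `M` of cardinality less than `c`. -/
abbrev SmallSubmodule (R M : Type v) [Ring R] [AddCommGroup M] [Module R M]
    (c : Cardinal.{v}) : Type v :=
  {N : Submodule R M // Cardinal.mk (N : Type v) < c}

namespace SmallSubmodule

variable {R : Type v} [Ring R] (M : ModuleCat.{v} R) (c : Cardinal.{v})

open Cardinal in
theorem isCardinalFiltered (hc : c.IsRegular) (hc' : ℵ₀ < c) (hR : #R < c) :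
    _root_.IsCardinalFiltered (SmallSubmodule R M c) c := by
  intro K _ hK F
  have hobj : #K < c := by
    refine (mk_le_of_injective (f := fun k : K ↦ Arrow.mk (𝟙 k)) fun k l h ↦ ?_).trans_lt hK
    exact congrArg (fun f : Arrow K ↦ f.left) h
  have hunion : #(⋃ k, ((F.obj k).1 : Set M)) < c :=
    (card_iUnion_lt_iff_forall_of_isRegular hc hobj).2 fun k ↦ (F.obj k).2
  exact ⟨{
    pt := ⟨Submodule.span R (⋃ k, ((F.obj k).1 : Set M)),
      Submodule.mk_span_lt hc' hR _ hunion⟩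
    ι :=
      { app := fun k ↦ homOfLE
          ((Set.subset_iUnion (fun k ↦ ((F.obj k).1 : Set M)) k).trans Submodule.subset_span)
        naturality := fun _ _ _ ↦ Subsingleton.elim _ _ } }⟩

/-- The tautological diagram of modules indexed by the small submodules of `M`. -/
def diagram : SmallSubmodule R M c ⥤ ModuleCat.{v} R where
  obj N := ModuleCat.of R N.1
  map f := ModuleCat.ofHom (Submodule.inclusion (leOfHom f))

/-- The inclusions of the small submodules of `M`. -/
def cocone : Cocone (diagram M c) where
  pt := M
  ι := { app := fun N ↦ ModuleCat.ofHom N.1.subtype }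

variable {M c}

theorem ι_apply_eq (s : Cocone (diagram M c)) {N P : SmallSubmodule R M c} (h : N ≤ P) {x : M}
    (hN : x ∈ N.1) : s.ι.app P ⟨x, h hN⟩ = s.ι.app N ⟨x, hN⟩ :=
  ConcreteCategory.congr_hom (s.w (homOfLE h)) (⟨x, hN⟩ : N.1)

open Cardinal in
theorem nonempty_isColimit_cocone (hc : ℵ₀ < c) (hR : #R < c) :
    Nonempty (IsColimit (cocone M c)) := by
  have hcover (t : Set M) (ht : t.Finite) : ∃ N : SmallSubmodule R M c, t ⊆ N.1 :=
    ⟨⟨Submodule.span R t, Submodule.mk_span_lt hc hR t (ht.lt_aleph0.trans hc)⟩,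
      Submodule.subset_span⟩
  have hmem (x : M) : ∃ N : SmallSubmodule R M c, x ∈ N.1 := by
    simpa using hcover {x} (Set.finite_singleton x)
  choose N hN using hmem
  have heq (s : Cocone (diagram M c)) (P : SmallSubmodule R M c) (x : M) (hx : x ∈ P.1) :
      s.ι.app (N x) ⟨x, hN x⟩ = s.ι.app P ⟨x, hx⟩ := by
    let Q : SmallSubmodule R M c := ⟨(N x).1 ⊓ P.1,
      (mk_le_of_injective (Submodule.inclusion_injective inf_le_right)).trans_lt P.2⟩
    exact (ι_apply_eq s (N := Q) (P := N x)
      (inf_le_left : (N x).1 ⊓ P.1 ≤ _) ⟨hN x, hx⟩).trans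
      (ι_apply_eq s (N := Q) (P := P)
      (inf_le_right : (N x).1 ⊓ P.1 ≤ _) ⟨hN x, hx⟩).symm
  let desc (s : Cocone (diagram M c)) : M →ₗ[R] s.pt :=
    { toFun := fun x ↦ s.ι.app (N x) ⟨x, hN x⟩
      map_add' := fun x y ↦ by
        obtain ⟨P, hP⟩ := hcover {x, y} (Set.toFinite _)
        have hx : x ∈ P.1 := hP (by simp)
        have hy : y ∈ P.1 := hP (by simp)
        rw [heq s P _ hx, heq s P _ hy, heq s P _ (add_mem hx hy)]
        exact map_add (s.ι.app P).hom ⟨x, hx⟩ ⟨y, hy⟩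
      map_smul' := fun r x ↦ by
        rw [heq s (N x) _ (Submodule.smul_mem _ r (hN x))]
        exact map_smul (s.ι.app (N x)).hom r ⟨x, hN x⟩ }
  exact ⟨{
    desc := fun s ↦ ModuleCat.ofHom (desc s)
    fac := fun s P ↦ by
      ext x
      exact heq s P x.1 x.2
    uniq := fun s m hm ↦ by
      ext x
      exact ConcreteCategory.congr_hom (hm (N x)) (⟨x, hN x⟩ : (N x).1) }⟩

end SmallSubmodule

/-- Let `𝒜` be a Grothendieck abelian category, `R` a ring, `F ⊣ G` an adjoint pair of
additive functors with `F` exact and counit an isomorphism (Gabriel–Popescu), and let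
`μ ≥ |R|` be infinite. Then for every regular `λ > μ`, every `λ`-presentable object `a`
of `𝒜` is isomorphic to `F N` for some `R`-module `N` of cardinality `< λ`, which may
moreover be taken to be a submodule of `G a`. -/
theorem stmt_1 {𝒜 : Type u} [Category.{v} 𝒜] [Abelian 𝒜] [HasColimits 𝒜] [AB5 𝒜]
    [HasSeparator 𝒜]
    (R : Type v) [Ring R]
    (F : ModuleCat.{v} R ⥤ 𝒜) (G : 𝒜 ⥤ ModuleCat.{v} R)
    [F.Additive] [G.Additive]
    (adj : F ⊣ G)
    [PreservesFiniteLimits F] [PreservesFiniteColimits F]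
    (hcounit : IsIso adj.counit)
    (μ : Cardinal.{v}) (hμ : Cardinal.aleph0 ≤ μ) (hR : Cardinal.mk R ≤ μ)
    (lam : Cardinal.{v}) (hreg : lam.IsRegular) (hlam : μ < lam)
    (a : 𝒜) (ha : IsPresentable lam a) :
    ∃ N : Submodule R (G.obj a), Cardinal.mk (N : Type v) < lam ∧
      Nonempty (a ≅ F.obj (ModuleCat.of R (N : Type v))) := by
  have hc : Cardinal.aleph0 < lam := hμ.trans_lt hlam
  have hR' : Cardinal.mk R < lam := hR.trans_lt hlam
  obtain ⟨hpres⟩ := ha _ (SmallSubmodule.isCardinalFiltered (G.obj a) lam hreg hc hR')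
  obtain ⟨hcolim⟩ := SmallSubmodule.nonempty_isColimit_cocone (M := G.obj a) hc hR'
  have : PreservesColimits F := adj.leftAdjoint_preservesColimits
  let e : F.obj (G.obj a) ≅ a := (asIso adj.counit).app a
  have hF := isColimitOfPreserves F hcolim
  obtain ⟨N, f, hf⟩ := Types.jointly_surjective_of_isColimit
    (isColimitOfPreserves (coyoneda.obj (op a)) hF) (e.inv)
  have : Mono (ModuleCat.ofHom N.1.subtype) :=
    (ModuleCat.mono_iff_injective _).2 N.1.injective_subtype
  let i : F.obj (ModuleCat.of R N.1) ⟶ F.obj (G.obj a) := F.map (ModuleCat.ofHom N.1.subtype)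
  let g : a ⟶ F.obj (ModuleCat.of R N.1) := f
  have hg : g ≫ i = e.inv := hf
  have : IsSplitEpi i := ⟨⟨e.hom ≫ g, by rw [Category.assoc, hg, e.hom_inv_id]⟩⟩
  have : IsIso i := isIso_of_mono_of_isSplitEpi i
  exact ⟨N.1, N.2, ⟨e.symm ≪≫ (asIso i).symm⟩⟩
end

section
/- Let 𝒜 be a Grothendieck abelian category, and fix a ring R together with an adjoint pair of additive functors F : Mod R → 𝒜 and G : 𝒜 → Mod R (F left adjoint to G) such that F is exact and the counit F ∘ G ≅ id is an isomorphism. Let μ be an infinite cardinal with μ ≥ |R| and let ν = μ⁺ be its successor cardinal. Then for every regular cardinal λ ≥ ν, the class of λ-presentable objects of 𝒜 is a Serre subcategory of 𝒜: it contains the zero object and is closed under subobjects, quotient objects, and extensions (if 0 → a → b → c → 0 is a short exact sequence with a and c λ-presentable, then b is λ-presentable). -/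
open CategoryTheory Limits Opposite

universe v u

namespace GabrielPopescu

lemma mk_finset_lt {T : Type v} {lam : Cardinal.{v}} (h₀ : Cardinal.aleph0 ≤ lam)
    (hT : Cardinal.mk T < lam) : Cardinal.mk (Finset T) < lam := by
  cases finite_or_infinite T
  · exact (Cardinal.lt_aleph0_of_finite _).trans_le h₀
  · rwa [Cardinal.mk_finset_of_infinite]

lemma mk_finsupp_lt {S R : Type v} [Zero R] {lam : Cardinal.{v}} (h₀ : Cardinal.aleph0 ≤ lam)
    (hS : Cardinal.mk S < lam) (hR : Cardinal.mk R < lam) : Cardinal.mk (S →₀ R) < lam := by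
  refine (Cardinal.mk_le_of_injective (Finsupp.graph_injective S R)).trans_lt
    (mk_finset_lt h₀ ?_)
  simpa using Cardinal.mul_lt_of_lt h₀ hS hR

lemma mk_span_lt {R M : Type v} [Ring R] [AddCommGroup M] [Module R M] {lam : Cardinal.{v}}
    (h₀ : Cardinal.aleph0 ≤ lam) (hR : Cardinal.mk R < lam) (S : Set M)
    (hS : Cardinal.mk S < lam) : Cardinal.mk (Submodule.span R S) < lam := by
  have h := Finsupp.range_linearCombination (R := R) (v := ((↑) : S → M))
  rw [Subtype.range_coe] at h
  rw [← h]
  exact (Cardinal.mk_le_of_surjective (LinearMap.surjective_rangeRestrict _)).trans_lt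
    (mk_finsupp_lt h₀ hS hR)

/-- In an abelian category, a quotient of a presentable object is presentable as soon as the
kernel is covered by a presentable object. -/
lemma isCardinalPresentable_of_epi_kernel {C : Type u} [Category.{v} C] [Abelian C]
    (lam : Cardinal.{v}) [Fact lam.IsRegular] {X Y Z : C} (p : Y ⟶ Z) [Epi p]
    (q : X ⟶ kernel p) [Epi q] (hX : IsCardinalPresentable X lam)
    (hY : IsCardinalPresentable Y lam) : IsCardinalPresentable Z lam := by
  let S : ShortComplex C := ShortComplex.mk (q ≫ kernel.ι p) p (by simp)
  have hS : S.Exact := by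
    rw [S.exact_iff_epi_kernel_lift]
    have : kernel.lift S.g S.f S.zero = q := by
      rw [← cancel_mono (kernel.ι _)]
      simp [S]
    rwa [this]
  have : Epi S.g := ‹Epi p›
  have (k : WalkingParallelPair) :
      IsCardinalPresentable ((parallelPair S.f 0).obj k) lam := by
    cases k <;> assumption
  exact isCardinalPresentable_of_isColimit _ hS.gIsCokernel lam
    (HasCardinalLT.of_le (by rw [hasCardinalLT_aleph0_iff]; infer_instance)
      (Fact.out : lam.IsRegular).aleph0_le)

section Modules

variable {R : Type v} [Ring R] {lam : Cardinal.{v}}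

lemma mk_le_of_mono {M N : ModuleCat.{v} R} (f : M ⟶ N) [Mono f] :
    Cardinal.mk M ≤ Cardinal.mk N :=
  Cardinal.mk_le_of_injective ((ModuleCat.mono_iff_injective f).1 inferInstance)

lemma isCardinalPresentable_free [Fact lam.IsRegular] {X : Type v} (hX : Cardinal.mk X < lam) :
    IsCardinalPresentable ((ModuleCat.free R).obj X) lam := by
  have : (forget (ModuleCat.{v} R)).IsCardinalAccessible lam :=
    ⟨fun J _ _ ↦ by
      have := isFiltered_of_isCardinalFiltered J lam
      infer_instance⟩
  have : IsCardinalPresentable X lam :=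
    ((hasCardinalLT_iff_cardinal_mk_lt X lam).2 hX).isCardinalPresentable
  exact (ModuleCat.adj R).isCardinalPresentable_leftAdjoint_obj lam X

lemma mk_free_lt (h₀ : Cardinal.aleph0 ≤ lam) (hR : Cardinal.mk R < lam) {X : Type v}
    (hX : Cardinal.mk X < lam) : Cardinal.mk ((ModuleCat.free R).obj X) < lam :=
  mk_finsupp_lt h₀ hX hR

lemma isCardinalPresentable_module [Fact lam.IsRegular] (hR : Cardinal.mk R < lam)
    (M : ModuleCat.{v} R) (hM : Cardinal.mk M < lam) : IsCardinalPresentable M lam := by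
  have h₀ := (Fact.out : lam.IsRegular).aleph0_le
  let p := (ModuleCat.adj R).counit.app M
  let q := (ModuleCat.adj R).counit.app (kernel p)
  have : Epi p := inferInstance
  have : Epi q := inferInstance
  have hK : Cardinal.mk (kernel p : ModuleCat.{v} R) < lam :=
    (mk_le_of_mono (kernel.ι p)).trans_lt (mk_free_lt h₀ hR hM)
  exact isCardinalPresentable_of_epi_kernel lam p q (isCardinalPresentable_free hK)
    (isCardinalPresentable_free hM)

/-- The diagram of submodules of `M` spanned by subsets of cardinality `< lam`. -/
noncomputable def spanDiagram (M : ModuleCat.{v} R) (lam : Cardinal.{v}) :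
    HasCardinalLT.Set M lam ⥤ ModuleCat.{v} R where
  obj S := ModuleCat.of R (Submodule.span R S.1)
  map f := ModuleCat.ofHom (Submodule.inclusion (Submodule.span_mono (leOfHom f)))

/-- The cocone on `spanDiagram M lam` given by the inclusions into `M`. -/
noncomputable def spanCocone (M : ModuleCat.{v} R) (lam : Cardinal.{v}) :
    Cocone (spanDiagram M lam) where
  pt := M
  ι := { app := fun S ↦ ModuleCat.ofHom (Submodule.span R S.1).subtype }

instance (M : ModuleCat.{v} R) (S : HasCardinalLT.Set M lam) :
    Mono ((spanCocone M lam).ι.app S) :=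
  (ModuleCat.mono_iff_injective _).2 Subtype.val_injective

/-- A module is the `lam`-filtered colimit of its submodules spanned by fewer than `lam`
elements. -/
lemma nonempty_isColimit_spanCocone [Fact lam.IsRegular] (M : ModuleCat.{v} R) :
    Nonempty (IsColimit (spanCocone M lam)) := by
  have := reflectsColimitsOfShape_of_reflectsIsomorphisms (J := HasCardinalLT.Set M lam)
    (G := forget (ModuleCat.{v} R))
  refine ⟨isColimitOfReflects (forget (ModuleCat.{v} R))
    (Types.FilteredColimit.isColimitOf' _ _ (fun x ↦ ?_) (fun S x y h ↦ ⟨S, 𝟙 _, ?_⟩))⟩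
  · have : Finite ({x} : Set M) := (Set.finite_singleton (α := M) x).to_subtype
    exact ⟨⟨{x}, hasCardinalLT_of_finite _ _ (Fact.out : lam.IsRegular).aleph0_le⟩,
      ⟨x, Submodule.subset_span rfl⟩, rfl⟩
  · obtain rfl : x = y := Subtype.ext h
    rfl

end Modules

section Localization

variable {𝒜 : Type u} [Category.{v} 𝒜] [Abelian 𝒜] {R : Type v} [Ring R]
  {F : ModuleCat.{v} R ⥤ 𝒜} {G : 𝒜 ⥤ ModuleCat.{v} R} (adj : F ⊣ G)
  [F.Additive] [PreservesFiniteLimits F] {lam : Cardinal.{v}} [Fact lam.IsRegular]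

include adj

/-- A morphism from a `lam`-filtered colimit of local modules to a local module is injective
as soon as the localization inverts it. -/
lemma mono_of_isIso_map (hR : Cardinal.mk R < lam) {J : Type v} [SmallCategory J]
    [CategoryTheory.IsCardinalFiltered J lam] {D : J ⥤ 𝒜} {t : Cocone (D ⋙ G)}
    (ht : IsColimit t) {y : 𝒜} (δ : t.pt ⟶ G.obj y) [IsIso (F.map δ)] : Mono δ := by
  have h₀ := (Fact.out : lam.IsRegular).aleph0_le
  rw [ModuleCat.mono_iff_injective, injective_iff_map_eq_zero]
  intro m hm
  let I : ModuleCat.{v} R := ModuleCat.of R (Submodule.span R {m})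
  let f : I ⟶ t.pt := ModuleCat.ofHom (Submodule.span R {m}).subtype
  have : Mono f := (ModuleCat.mono_iff_injective _).2 Subtype.val_injective
  have hI : Cardinal.mk I < lam :=
    mk_span_lt h₀ hR _ ((Cardinal.lt_aleph0_of_finite _).trans_le h₀)
  have hf : f ≫ δ = 0 := by
    ext ⟨x, hx⟩
    obtain ⟨r, rfl⟩ := Submodule.mem_span_singleton.1 hx
    change δ (r • m) = 0
    rw [map_smul, hm, smul_zero]
  have hFf : F.map f = 0 := by
    rw [← cancel_mono (F.map δ), ← F.map_comp, hf, F.map_zero, zero_comp]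
  have hFI : IsZero (F.obj I) := by
    rw [IsZero.iff_id_eq_zero, ← cancel_mono (F.map f), hFf, comp_zero, comp_zero]
  have := isCardinalPresentable_module hR I hI
  obtain ⟨j, g, hg⟩ := IsCardinalPresentable.exists_hom_of_isColimit lam ht f
  have hg₀ : g = 0 := (adj.homEquiv _ _).symm.injective (hFI.eq_of_src _ _)
  rw [hg₀, zero_comp] at hg
  exact (congr($hg ⟨m, Submodule.mem_span_singleton_self m⟩)).symm

/-- A morphism from a `lam`-filtered colimit of local modules to a local module is an
isomorphism as soon as the localization inverts it. -/
lemma isIso_of_isIso_map (hR : Cardinal.mk R < lam) {J : Type v} [SmallCategory J]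
    [CategoryTheory.IsCardinalFiltered J lam] {D : J ⥤ 𝒜} {t : Cocone (D ⋙ G)}
    (ht : IsColimit t) {y : 𝒜} (δ : t.pt ⟶ G.obj y) [IsIso (F.map δ)] : IsIso δ := by
  have := mono_of_isIso_map adj hR ht δ
  suffices Epi δ from isIso_of_mono_of_epi δ
  rw [ModuleCat.epi_iff_surjective]
  intro z
  let r : ModuleCat.of R R ⟶ G.obj y := ModuleCat.ofHom (LinearMap.toSpanSingleton R _ z)
  have sq := IsPullback.of_hasPullback r δ
  have : IsIso (F.map (pullback.fst r δ)) := (sq.map F).isIso_fst_of_isIso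
  have := isCardinalPresentable_module hR (pullback r δ)
    ((mk_le_of_mono (pullback.fst r δ)).trans_lt hR)
  obtain ⟨j, g, hg⟩ := IsCardinalPresentable.exists_hom_of_isColimit lam ht (pullback.snd r δ)
  let h : ModuleCat.of R R ⟶ G.obj (D.obj j) :=
    adj.homEquiv _ _ (inv (F.map (pullback.fst r δ)) ≫ (adj.homEquiv _ _).symm g)
  have hh : pullback.fst r δ ≫ h = g := by
    rw [← adj.homEquiv_naturality_left, IsIso.hom_inv_id_assoc, Equiv.apply_symm_apply]
  have key : h ≫ t.ι.app j ≫ δ = r := by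
    apply (adj.homEquiv _ _).symm.injective
    rw [← cancel_epi (F.map (pullback.fst r δ)), ← adj.homEquiv_naturality_left_symm,
      ← adj.homEquiv_naturality_left_symm, reassoc_of% hh, reassoc_of% hg, pullback.condition]
  refine ⟨(h ≫ t.ι.app j) (1 : R), ?_⟩
  have := congr($key (1 : R))
  simpa [r] using this

/-- The right adjoint of an exact localization of `Mod R` preserves `lam`-filtered colimits
when `|R| < lam`. -/
lemma isCardinalAccessible_of_isIso_counit (hcounit : IsIso adj.counit)
    (hR : Cardinal.mk R < lam) : G.IsCardinalAccessible lam where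
  preservesColimitOfShape J _ _ := ⟨fun {D} ↦ ⟨fun {c} hc ↦ ⟨by
    have : PreservesColimitsOfSize.{v, v} F := adj.leftAdjoint_preservesColimits
    let t := colimit.cocone (D ⋙ G)
    have ht : IsColimit t := colimit.isColimit (D ⋙ G)
    let δ : t.pt ⟶ G.obj c.pt := ht.desc (G.mapCocone c)
    let e : D ⋙ G ⋙ F ≅ D := Functor.isoWhiskerLeft D (asIso adj.counit)
    have hFt : IsColimit (F.mapCocone t) := isColimitOfPreserves F ht
    have hFδ : IsIso (F.map δ) := by
      have h : F.map δ = (hFt.coconePointsIsoOfNatIso hc e).hom ≫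
          inv (adj.counit.app c.pt) := by
        refine hFt.hom_ext fun j ↦ ?_
        rw [← cancel_mono (adj.counit.app c.pt)]
        have h₁ : F.map (t.ι.app j) ≫ F.map δ = F.map (G.map (c.ι.app j)) := by
          rw [← F.map_comp, ht.fac]
          rfl
        have h₂ := hFt.comp_coconePointsIsoOfNatIso_hom hc e j
        simp only [Category.assoc, IsIso.inv_hom_id, Category.comp_id, h₂]
        rw [Functor.mapCocone_ι_app, reassoc_of% h₁]
        simp [e]
      rw [h]
      infer_instance
    have := isIso_of_isIso_map adj hR ht δ
    exact ht.ofPointIso (t := G.mapCocone c)⟩⟩⟩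

end Localization

section Generated

variable {𝒜 : Type u} [Category.{v} 𝒜] [Abelian 𝒜] {R : Type v} [Ring R]
  {F : ModuleCat.{v} R ⥤ 𝒜} {lam : Cardinal.{v}}

variable (F lam) in
/-- An object of `𝒜` is generated by fewer than `lam` elements, relative to `F : Mod R ⥤ 𝒜`,
if it is a quotient of the image under `F` of a module of cardinality `< lam`. -/
def IsGenerated (x : 𝒜) : Prop :=
  ∃ (M : ModuleCat.{v} R) (f : F.obj M ⟶ x), Cardinal.mk M < lam ∧ Epi f

omit [Abelian 𝒜] in
lemma IsGenerated.of_epi {x y : 𝒜} (hx : IsGenerated F lam x) (p : x ⟶ y) [Epi p] :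
    IsGenerated F lam y := by
  obtain ⟨M, f, hM, _⟩ := hx
  exact ⟨M, f ≫ p, hM, inferInstance⟩

variable {G : 𝒜 ⥤ ModuleCat.{v} R} (adj : F ⊣ G) [IsIso adj.counit]

include adj

omit [Abelian 𝒜] in
lemma epi_map_homEquiv {M : ModuleCat.{v} R} {x : 𝒜} (f : F.obj M ⟶ x) [Epi f] :
    Epi (F.map (adj.homEquiv _ _ f)) := by
  have h : F.map (adj.homEquiv _ _ f) = f ≫ inv (adj.counit.app x) := by
    rw [IsIso.eq_comp_inv, ← adj.homEquiv_counit, Equiv.symm_apply_apply]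
  rw [h]
  infer_instance

lemma IsGenerated.of_mono [PreservesFiniteLimits F] {x y : 𝒜} (hy : IsGenerated F lam y)
    (i : x ⟶ y) [Mono i] : IsGenerated F lam x := by
  obtain ⟨M, f, hM, _⟩ := hy
  have : PreservesLimitsOfSize.{v, v} G := adj.rightAdjoint_preservesLimits
  have := epi_map_homEquiv adj f
  have sq := (IsPullback.of_hasPullback (adj.homEquiv _ _ f) (G.map i)).map F
  have : Epi (F.map (pullback.snd (adj.homEquiv _ _ f) (G.map i))) :=
    (MorphismProperty.epimorphisms 𝒜).of_isPullback sq ‹_›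
  exact ⟨pullback (adj.homEquiv _ _ f) (G.map i), F.map (pullback.snd _ _) ≫ adj.counit.app x,
    (mk_le_of_mono (pullback.fst _ _)).trans_lt hM, inferInstance⟩

/-- If `p : b ⟶ c` is an epimorphism and `c` is generated by fewer than `lam` elements, then
so is some subobject of `b` surjecting onto `c`. -/
lemma IsGenerated.exists_lift [PreservesFiniteLimits F] (h₀ : Cardinal.aleph0 ≤ lam)
    (hR : Cardinal.mk R < lam) {b c : 𝒜} (hc : IsGenerated F lam c) (p : b ⟶ c) [Epi p] :
    ∃ (M : ModuleCat.{v} R) (g : F.obj M ⟶ b), Cardinal.mk M < lam ∧ Epi (g ≫ p) := by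
  obtain ⟨M, f, hM, _⟩ := hc
  let f' := adj.homEquiv _ _ f
  let Q := pullback f' (G.map p)
  let π : Q ⟶ M := pullback.fst f' (G.map p)
  have hFGp : Epi (F.map (G.map p)) := by
    have h : F.map (G.map p) = adj.counit.app b ≫ p ≫ inv (adj.counit.app c) := by
      simp [← adj.counit_naturality_assoc]
    rw [h]
    infer_instance
  have sq := (IsPullback.of_hasPullback f' (G.map p)).map F
  have hπ : Epi (F.map π) := (MorphismProperty.epimorphisms 𝒜).of_isPullback sq.flip hFGp
  have hι : Epi (F.map (Limits.image.ι π)) := by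
    rw [← Limits.image.fac π, F.map_comp] at hπ
    exact epi_of_epi (F.map (factorThruImage π)) _
  have : PreservesColimitsOfSize.{v, v} F := adj.leftAdjoint_preservesColimits
  let L := (ModuleCat.free R).obj (Limits.image π : ModuleCat.{v} R)
  let e : L ⟶ Limits.image π := (ModuleCat.adj R).counit.app _
  have : Projective L := (ModuleCat.adj R).map_projective _ inferInstance
  have : Epi e := inferInstance
  let k : L ⟶ Q := Projective.factorThru e (factorThruImage π)
  have hk : k ≫ π = e ≫ Limits.image.ι π := by
    rw [← Projective.factorThru_comp e (factorThruImage π), Category.assoc, Limits.image.fac]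
  let εb : F.obj (G.obj b) ⟶ b := adj.counit.app b
  let εc : F.obj (G.obj c) ⟶ c := adj.counit.app c
  have hε : F.map (G.map p) ≫ εc = εb ≫ p := adj.counit_naturality p
  have hf : F.map f' ≫ εc = f :=
    (adj.homEquiv_counit _ _ f').symm.trans ((adj.homEquiv _ _).symm_apply_apply f)
  refine ⟨L, F.map (k ≫ pullback.snd f' (G.map p)) ≫ εb,
    mk_free_lt h₀ hR ((mk_le_of_mono (Limits.image.ι π)).trans_lt hM), ?_⟩
  have h : (F.map (k ≫ pullback.snd f' (G.map p)) ≫ εb) ≫ p =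
      F.map e ≫ F.map (Limits.image.ι π) ≫ f := by
    rw [Category.assoc, ← hε, ← F.map_comp_assoc, Category.assoc,
      ← pullback.condition, reassoc_of% hk, F.map_comp, F.map_comp, Category.assoc,
      Category.assoc, hf]
  rw [h]
  infer_instance

lemma IsGenerated.of_shortExact [F.Additive] [PreservesFiniteLimits F]
    (h₀ : Cardinal.aleph0 ≤ lam)
    (hR : Cardinal.mk R < lam) {S : ShortComplex 𝒜} (hS : S.ShortExact)
    (h₁ : IsGenerated F lam S.X₁) (h₃ : IsGenerated F lam S.X₃) : IsGenerated F lam S.X₂ := by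
  have := hS.epi_g
  obtain ⟨A, f, hA, _⟩ := h₁
  obtain ⟨L, g, hL, _⟩ := h₃.exists_lift adj h₀ hR S.g
  refine ⟨A ⊞ L, F.map biprod.fst ≫ f ≫ S.f + F.map biprod.snd ≫ g, ?_, ?_⟩
  · refine (mk_le_of_mono (ModuleCat.biprodIsoProd A L).hom).trans_lt ?_
    change Cardinal.mk (A × L) < lam
    simpa using Cardinal.mul_lt_of_lt h₀ hA hL
  · refine Preadditive.epi_of_cancel_zero _ fun h hh ↦ ?_
    have hA₀ := F.map biprod.inl ≫= hh
    have hL₀ := F.map biprod.inr ≫= hh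
    simp only [Preadditive.add_comp, Preadditive.comp_add, Category.assoc, comp_zero,
      ← F.map_comp_assoc, biprod.inl_fst, biprod.inl_snd, biprod.inr_fst, biprod.inr_snd,
      F.map_id, F.map_zero, zero_comp, Category.id_comp, add_zero, zero_add] at hA₀ hL₀
    have hA₁ : S.f ≫ h = 0 := by rw [← cancel_epi f, hA₀, comp_zero]
    have hfac : S.g ≫ hS.exact.desc h hA₁ = h := hS.exact.g_desc _ _
    have hdesc : hS.exact.desc h hA₁ = 0 := by
      rw [← cancel_epi (g ≫ S.g), Category.assoc, hfac, hL₀, comp_zero]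
    rw [← hfac, hdesc, comp_zero]

lemma isGenerated_iff [F.Additive] [PreservesFiniteLimits F] [Fact lam.IsRegular]
    (hR : Cardinal.mk R < lam) (x : 𝒜) :
    IsGenerated F lam x ↔ IsCardinalPresentable x lam := by
  constructor
  · have := isCardinalAccessible_of_isIso_counit (lam := lam) adj inferInstance hR
    have hF (M : ModuleCat.{v} R) (hM : Cardinal.mk M < lam) :
        IsCardinalPresentable (F.obj M) lam := by
      have := isCardinalPresentable_module hR M hM
      exact adj.isCardinalPresentable_leftAdjoint_obj lam M
    rintro ⟨M, f, hM, _⟩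
    obtain ⟨N, q, hN, _⟩ := IsGenerated.of_mono adj ⟨M, 𝟙 _, hM, inferInstance⟩ (kernel.ι f)
    exact isCardinalPresentable_of_epi_kernel lam f q (hF N hN) (hF M hM)
  · intro hx
    have : PreservesColimitsOfSize.{v, v} F := adj.leftAdjoint_preservesColimits
    let ε : F.obj (G.obj x) ⟶ x := adj.counit.app x
    have : IsIso ε := inferInstanceAs (IsIso (adj.counit.app x))
    obtain ⟨ht⟩ := nonempty_isColimit_spanCocone (lam := lam) (G.obj x)
    let ε' : x ⟶ F.obj (G.obj x) := inv ε
    obtain ⟨S, p, hp⟩ := IsCardinalPresentable.exists_hom_of_isColimit lam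
      (isColimitOfPreserves F ht) ε'
    let ι : F.obj ((spanDiagram (G.obj x) lam).obj S) ⟶ F.obj (G.obj x) :=
      F.map ((spanCocone (G.obj x) lam).ι.app S)
    have h : p ≫ ι ≫ ε = 𝟙 x :=
      (Category.assoc _ _ _).symm.trans ((congrArg (· ≫ ε) hp).trans (IsIso.inv_hom_id ε))
    have : IsSplitEpi (ι ≫ ε) := ⟨⟨⟨p, h⟩⟩⟩
    exact ⟨_, ι ≫ ε, mk_span_lt (Fact.out : lam.IsRegular).aleph0_le hR S.1
      ((hasCardinalLT_iff_cardinal_mk_lt _ _).1 S.2), inferInstance⟩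

end Generated

lemma isPresentable_iff {C : Type u} [Category.{v} C] (lam : Cardinal.{v}) [Fact lam.IsRegular]
    (x : C) : _root_.IsPresentable lam x ↔ IsCardinalPresentable x lam := by
  have h (J : Type v) [SmallCategory J] :
      _root_.IsCardinalFiltered J lam ↔ CategoryTheory.IsCardinalFiltered J lam :=
    ⟨fun hJ ↦ ⟨fun {A} _ K hA ↦ hJ A ((hasCardinalLT_iff_cardinal_mk_lt _ _).1 hA) K⟩,
      fun hJ A _ hA K ↦ hJ.nonempty_cocone K ((hasCardinalLT_iff_cardinal_mk_lt _ _).2 hA)⟩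
  exact ⟨fun hx ↦ ⟨fun J _ hJ ↦ (hx J ((h J).2 hJ)).some⟩,
    fun hx J _ hJ ↦ by
      have := (h J).1 hJ
      exact ⟨hx.preservesColimitOfShape J⟩⟩

end GabrielPopescu

/-- Let `𝒜` be a Grothendieck abelian category, `R` a ring, `F ⊣ G` an adjoint pair of
additive functors with `F` exact and counit an isomorphism (Gabriel–Popescu), let
`μ ≥ |R|` be infinite and `ν = μ⁺` its successor. Then for every regular cardinal
`λ ≥ ν`, the `λ`-presentable objects of `𝒜` form a Serre subcategory: the class
contains every zero object and is closed under subobjects, quotients and extensions. -/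
theorem stmt_2 {𝒜 : Type u} [Category.{v} 𝒜] [Abelian 𝒜] [HasColimits 𝒜] [AB5 𝒜]
    [HasSeparator 𝒜]
    (R : Type v) [Ring R]
    (F : ModuleCat.{v} R ⥤ 𝒜) (G : 𝒜 ⥤ ModuleCat.{v} R)
    [F.Additive] [G.Additive]
    (adj : F ⊣ G)
    [PreservesFiniteLimits F] [PreservesFiniteColimits F]
    (hcounit : IsIso adj.counit)
    (μ : Cardinal.{v}) (hμ : Cardinal.aleph0 ≤ μ) (hR : Cardinal.mk R ≤ μ)
    (ν : Cardinal.{v}) (hν : ν = Order.succ μ)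
    (lam : Cardinal.{v}) (hreg : lam.IsRegular) (hlam : ν ≤ lam) :
    (∀ x : 𝒜, IsZero x → IsPresentable lam x) ∧
    (∀ (x y : 𝒜) (f : x ⟶ y), Mono f → IsPresentable lam y → IsPresentable lam x) ∧
    (∀ (x y : 𝒜) (f : x ⟶ y), Epi f → IsPresentable lam x → IsPresentable lam y) ∧
    (∀ (S : ShortComplex 𝒜), S.ShortExact →
      IsPresentable lam S.X₁ → IsPresentable lam S.X₃ → IsPresentable lam S.X₂) := by
  have : Fact lam.IsRegular := ⟨hreg⟩
  have h₀ : Cardinal.aleph0 ≤ lam := hreg.aleph0_le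
  have hR' : Cardinal.mk R < lam := hR.trans_lt ((Order.lt_succ μ).trans_le (hν ▸ hlam))
  have key (x : 𝒜) : IsPresentable lam x ↔ GabrielPopescu.IsGenerated F lam x :=
    (GabrielPopescu.isPresentable_iff lam x).trans
      (GabrielPopescu.isGenerated_iff adj hR' x).symm
  simp only [key]
  refine ⟨fun x hx ↦ ?_, fun x y f _ hy ↦ hy.of_mono adj f, fun x y f _ hx ↦ hx.of_epi f,
    fun S hS h₁ h₃ ↦ .of_shortExact adj h₀ hR' hS h₁ h₃⟩
  exact ⟨ModuleCat.of R PUnit, 0, (Cardinal.lt_aleph0_of_finite _).trans_le h₀, hx.epi _⟩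
end

section
/- Let 𝒜 be a Grothendieck abelian category, and fix a ring R together with an adjoint pair of additive functors F : Mod R → 𝒜 and G : 𝒜 → Mod R (F left adjoint to G) such that F is exact and the counit F ∘ G ≅ id is an isomorphism. Let μ be an infinite cardinal with μ ≥ |R| and let ν = μ⁺ be its successor cardinal. Then for every regular cardinal λ ≥ ν and every object a of 𝒜, the partially ordered set of those subobjects of a which are λ-presentable is λ-filtered (every subset of cardinality < λ has an upper bound in it), and a is the colimit (equivalently, the supremum in the subobject lattice) of this λ-filtered system of λ-presentable subobjects. -/
open CategoryTheory Limits Opposite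

universe v u

lemma HasCardinalLT.span {R M : Type v} [Ring R] [AddCommGroup M] [Module R M]
    {κ : Cardinal.{v}} {S : Set M} (hS : HasCardinalLT S κ) (hκ : Cardinal.aleph0 < κ)
    (hR : HasCardinalLT R κ) : HasCardinalLT (Submodule.span R S) κ := by
  have hL : HasCardinalLT (List (R × S)) κ := by
    have := hasCardinalLT_prod hκ.le hR hS
    rw [hasCardinalLT_iff_cardinal_mk_lt] at this ⊢
    exact (Cardinal.mk_list_le_max _).trans_lt (max_lt hκ this)
  let e (l : List (R × S)) : Submodule.span R S :=
    (l.map fun p ↦ p.1 • (⟨p.2, Submodule.subset_span p.2.2⟩ : Submodule.span R S)).sum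
  refine hL.of_surjective e ?_
  rintro ⟨x, hx⟩
  suffices ∃ l, (e l : M) = x from this.imp fun l hl ↦ Subtype.ext hl
  induction hx using Submodule.span_induction with
  | mem x hx => exact ⟨[(1, ⟨x, hx⟩)], by simp [e]⟩
  | zero => exact ⟨[], by simp [e]⟩
  | add x y _ _ hx hy =>
    obtain ⟨l, rfl⟩ := hx
    obtain ⟨l', rfl⟩ := hy
    exact ⟨l ++ l', by simp [e]⟩
  | smul r x _ hx =>
    obtain ⟨l, rfl⟩ := hx
    refine ⟨l.map fun p ↦ (r * p.1, p.2), ?_⟩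
    rw [← Submodule.coe_smul]
    simp [e, List.smul_sum, Function.comp_def, mul_smul]

namespace ModuleCat

variable {R : Type v} [Ring R] {κ : Cardinal.{v}} [Fact κ.IsRegular]

lemma isCardinalPresentable_of_hasCardinalLT (hR : HasCardinalLT R κ) (M : ModuleCat.{v} R)
    (hM : HasCardinalLT M κ) : IsCardinalPresentable M κ where
  preservesColimitOfShape J _ _ := ⟨fun {D} ↦ ⟨fun {c} hc ↦ ⟨by
    have := isFiltered_of_isCardinalFiltered J κ
    have hκ : Cardinal.aleph0 ≤ κ := (Fact.out : κ.IsRegular).aleph0_le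
    have hc' := isColimitOfPreserves (forget (ModuleCat.{v} R)) hc
    have types (T : Type v) (hT : HasCardinalLT T κ) :
        PreservesColimitsOfShape J (coyoneda.obj (op T)) :=
      have := hT.isCardinalPresentable
      preservesColimitsOfShape_of_isCardinalPresentable T κ J
    have := types M hM
    have separate {T : Type v} (hT : HasCardinalLT T κ) {j : J} (x y : T → D.obj j)
        (h : ∀ t, c.ι.app j (x t) = c.ι.app j (y t)) :
        ∃ (k : J) (a : j ⟶ k), ∀ t, D.map a (x t) = D.map a (y t) := by
      have := types T hT
      obtain ⟨k, a, ha⟩ := exists_eq_of_preservesColimit_coyoneda_self hc'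
        (X := T) (i := j) (↾x) (↾y) (by ext t; exact h t)
      exact ⟨k, a, fun t ↦ ConcreteCategory.congr_hom ha t⟩
    refine Types.FilteredColimit.isColimitOf' _ _ (fun (f : M ⟶ c.pt) ↦ ?_)
      (fun j (f : M ⟶ D.obj j) (g : M ⟶ D.obj j) (h : f ≫ c.ι.app j = g ≫ c.ι.app j) ↦ ?_)
    · obtain ⟨j, g, hg⟩ := exists_hom_of_preservesColimit_coyoneda hc' (X := M) (↾f)
      replace hg (m : M) : c.ι.app j (g m) = f m := ConcreteCategory.congr_hom hg m
      have hT := (hasCardinalLT_sum_iff (M × M) (R × M) κ hκ).2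
        ⟨hasCardinalLT_prod hκ hM hM, hasCardinalLT_prod hκ hR hM⟩
      obtain ⟨k, a, ha⟩ := separate hT
        (Sum.elim (fun p ↦ g (p.1 + p.2)) (fun p ↦ g (p.1 • p.2)))
        (Sum.elim (fun p ↦ (g p.1 + g p.2 : D.obj j)) (fun p ↦ (p.1 • g p.2 : D.obj j))) (by
          rintro (⟨m, n⟩ | ⟨r, m⟩)
          · simp [hg]
          · simp [hg])
      let φ : M →ₗ[R] D.obj k :=
        { toFun m := D.map a (g m)
          map_add' m n := by simpa using ha (.inl (m, n))
          map_smul' r m := by simpa using ha (.inr (r, m)) }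
      refine ⟨k, ofHom φ, ?_⟩
      change f = ofHom φ ≫ c.ι.app k
      ext m
      have := ConcreteCategory.congr_hom (c.w a) (g m)
      simp_all [φ]
    · obtain ⟨k, a, ha⟩ := separate hM f g (fun m ↦ ConcreteCategory.congr_hom h m)
      exact ⟨k, a, ModuleCat.hom_ext (LinearMap.ext ha)⟩⟩⟩⟩

end ModuleCat

namespace CategoryTheory.Adjunction

variable {𝒜 : Type u} [Category.{v} 𝒜] [Abelian 𝒜] {R : Type v} [Ring R]
  {F : ModuleCat.{v} R ⥤ 𝒜} {G : 𝒜 ⥤ ModuleCat.{v} R}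

/-- Suppose that `u : L ⟶ G.obj x` becomes an isomorphism after applying an exact left
adjoint `F` of `G`, and that any morphism from a module of cardinality `< κ` to `L` factors
through an object in the image of `G`. If `|R| < κ`, then `u` is an isomorphism. -/
lemma isIso_of_isIso_map_of_factors (adj : F ⊣ G) [F.Additive] [PreservesFiniteLimits F]
    {κ : Cardinal.{v}} (hR : HasCardinalLT R κ) {L : ModuleCat.{v} R} {x : 𝒜}
    (u : L ⟶ G.obj x) [IsIso (F.map u)]
    (hL : ∀ (N : ModuleCat.{v} R) (_ : HasCardinalLT N κ) (f : N ⟶ L),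
      ∃ (d : 𝒜) (p : N ⟶ G.obj d) (q : G.obj d ⟶ L), p ≫ q = f) : IsIso u := by
  have huinj : Function.Injective u := by
    refine (injective_iff_map_eq_zero u.hom).2 fun k hk ↦ ?_
    let N := Submodule.span R {k}
    let ι : ModuleCat.of R N ⟶ L := ModuleCat.ofHom N.subtype
    have : Mono ι := (ModuleCat.mono_iff_injective _).2 N.injective_subtype
    have hN : HasCardinalLT N κ := by
      refine hR.of_surjective
        (fun r ↦ (⟨r • k, N.smul_mem r (Submodule.mem_span_singleton_self k)⟩ : N)) ?_
      rintro ⟨n, hn⟩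
      obtain ⟨r, rfl⟩ := Submodule.mem_span_singleton.1 hn
      exact ⟨r, rfl⟩
    have hιu : ι ≫ u = 0 := by
      ext ⟨n, hn⟩
      obtain ⟨r, rfl⟩ := Submodule.mem_span_singleton.1 hn
      change u.hom (r • k) = 0
      simp_all
    have hFι : F.map ι = 0 := by
      rw [← cancel_mono (F.map u), ← F.map_comp, hιu, F.map_zero, zero_comp]
    obtain ⟨d, p, q, hpq⟩ := hL _ hN ι
    have hF0 : IsZero (F.obj (ModuleCat.of R N)) := IsZero.of_mono_eq_zero _ hFι
    have hp : p = 0 := (adj.homEquiv _ _).symm.injective (hF0.eq_of_src _ _)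
    have hι : ι = 0 := by rw [← hpq, hp, zero_comp]
    exact ConcreteCategory.congr_hom hι (⟨k, Submodule.mem_span_singleton_self k⟩ : N)
  have : Mono u := (ModuleCat.mono_iff_injective u).2 huinj
  have : Epi u := by
    refine (ModuleCat.epi_iff_surjective u).2 fun y ↦ ?_
    let t : ModuleCat.of R R ⟶ G.obj x := ModuleCat.ofHom (LinearMap.toSpanSingleton R _ y)
    have sq := IsPullback.of_hasPullback u t
    have : IsIso (F.map (pullback.snd u t)) := (sq.map F).isIso_snd_of_isIso
    have hP : HasCardinalLT (pullback u t : ModuleCat.{v} R) κ :=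
      hR.of_injective _ ((ModuleCat.mono_iff_injective (pullback.snd u t)).1 inferInstance)
    obtain ⟨d, p, q, hpq⟩ := hL _ hP (pullback.fst u t)
    have extend (z : 𝒜) {f g : ModuleCat.of R R ⟶ G.obj z}
        (h : pullback.snd u t ≫ f = pullback.snd u t ≫ g) : f = g := by
      apply (adj.homEquiv _ _).symm.injective
      rw [← cancel_epi (F.map (pullback.snd u t)), ← adj.homEquiv_naturality_left_symm,
        ← adj.homEquiv_naturality_left_symm, h]
    let e : ModuleCat.of R R ⟶ G.obj d :=
      adj.homEquiv _ _ (inv (F.map (pullback.snd u t)) ≫ (adj.homEquiv _ _).symm p)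
    have he : pullback.snd u t ≫ e = p := by
      simp [e, ← adj.homEquiv_naturality_left]
    have hw : (e ≫ q) ≫ u = t := by
      apply extend
      rw [Category.assoc, reassoc_of% he, reassoc_of% hpq, pullback.condition]
    refine ⟨(e ≫ q) (1 : R), ?_⟩
    have := ConcreteCategory.congr_hom hw (1 : R)
    simpa [t] using this
  exact isIso_of_mono_of_epi u

variable (adj : F ⊣ G) [F.Additive] [PreservesFiniteLimits F] [IsIso adj.counit]
  {κ : Cardinal.{v}} [Fact κ.IsRegular]

include adj in
/-- The right adjoint in a Gabriel-Popescu presentation preserves `κ`-filtered colimits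
as soon as `|R| < κ`. -/
lemma isCardinalAccessible_of_isIso_counit (hR : HasCardinalLT R κ) :
    G.IsCardinalAccessible κ where
  preservesColimitOfShape J _ _ := ⟨fun {D} ↦ ⟨fun {c} hc ↦ ⟨by
    have := adj.leftAdjoint_preservesColimits
    let hl := colimit.isColimit (D ⋙ G)
    let u := hl.desc (G.mapCocone c)
    have hu (j : J) : colimit.ι (D ⋙ G) j ≫ u = G.map (c.ι.app j) := hl.fac (G.mapCocone c) j
    have : IsIso (F.map u) := by
      let hFl := isColimitOfPreserves F hl
      let α : (D ⋙ G) ⋙ F ≅ D := Functor.isoWhiskerLeft D (asIso adj.counit)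
      have h : F.map u = (hFl.coconePointsIsoOfNatIso hc α).hom ≫ inv (adj.counit.app c.pt) := by
        refine hFl.hom_ext fun j ↦ ?_
        rw [IsColimit.comp_coconePointsIsoOfNatIso_hom_assoc]
        suffices F.map (G.map (c.ι.app j)) =
            adj.counit.app (D.obj j) ≫ c.ι.app j ≫ inv (adj.counit.app c.pt) by
          simpa [α, ← Functor.map_comp, hu]
        rw [← Category.assoc, IsIso.eq_comp_inv]
        exact adj.counit_naturality _
      rw [h]
      infer_instance
    have : IsIso u := by
      refine isIso_of_isIso_map_of_factors adj hR u fun N hN f ↦ ?_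
      have := ModuleCat.isCardinalPresentable_of_hasCardinalLT hR N hN
      have := preservesColimitsOfShape_of_isCardinalPresentable N κ J
      obtain ⟨j, p, hp⟩ := exists_hom_of_preservesColimit_coyoneda hl f
      exact ⟨D.obj j, p, colimit.ι (D ⋙ G) j, hp⟩
    exact IsColimit.ofPointIso hl (i := this)⟩⟩⟩

end CategoryTheory.Adjunction

namespace ModuleCat

variable {R : Type v} [Ring R] (M : ModuleCat.{v} R) (κ : Cardinal.{v})

/-- The preorder of submodules of cardinality `< κ`. -/
abbrev SmallSubmodule := { N : Submodule R M // HasCardinalLT N κ }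

/-- The tautological diagram of modules indexed by the submodules of cardinality `< κ`. -/
def smallSubmoduleFunctor : SmallSubmodule M κ ⥤ ModuleCat.{v} R where
  obj N := of R N.1
  map f := ofHom (Submodule.inclusion f.le)

/-- The cocone over `smallSubmoduleFunctor M κ` given by the inclusions. -/
def smallSubmoduleCocone : Cocone (smallSubmoduleFunctor M κ) where
  pt := M
  ι := { app N := ofHom N.1.subtype }

variable {κ} in
lemma hasCardinalLT_iSup [Fact κ.IsRegular] (hκ : Cardinal.aleph0 < κ) (hR : HasCardinalLT R κ)
    {ι : Type*} (hι : HasCardinalLT ι κ) (N : ι → Submodule R M)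
    (hN : ∀ i, HasCardinalLT (N i) κ) : HasCardinalLT (⨆ i, N i : Submodule R M) κ := by
  rw [Submodule.iSup_eq_span]
  exact (hasCardinalLT_iUnion (fun i ↦ (N i : Set M)) hι hN).span hκ hR

variable [Fact κ.IsRegular] (hκ : Cardinal.aleph0 < κ) (hR : HasCardinalLT R κ)

include hκ hR

lemma isCardinalFiltered_smallSubmodule :
    CategoryTheory.IsCardinalFiltered (SmallSubmodule M κ) κ :=
  isCardinalFiltered_preorder _ _ fun ι N hι ↦
    ⟨⟨⨆ i, (N i).1, hasCardinalLT_iSup M hκ hR (by rwa [hasCardinalLT_iff_cardinal_mk_lt]) _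
      fun i ↦ (N i).2⟩, fun i ↦ le_iSup (fun i ↦ (N i).1) i⟩

/-- A module is the colimit of its submodules of cardinality `< κ`. -/
lemma nonempty_isColimit_smallSubmoduleCocone :
    Nonempty (IsColimit (smallSubmoduleCocone M κ)) := by
  have := isCardinalFiltered_smallSubmodule M κ hκ hR
  have := isFiltered_of_isCardinalFiltered (SmallSubmodule M κ) κ
  have : ReflectsColimitsOfShape (SmallSubmodule M κ) (forget (ModuleCat.{v} R)) :=
    reflectsColimitsOfShape_of_reflectsIsomorphisms
  refine ⟨isColimitOfReflects (forget (ModuleCat.{v} R)) ?_⟩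
  refine Types.FilteredColimit.isColimitOf' _ _ (fun (x : M) ↦ ?_)
    (fun N _ _ h ↦ ⟨N, 𝟙 _, congrArg _ (Subtype.ext h)⟩)
  exact ⟨⟨_, (hasCardinalLT_of_finite ({x} : Set M) κ hκ.le).span hκ hR⟩,
    ⟨x, Submodule.mem_span_singleton_self x⟩, rfl⟩

end ModuleCat

lemma isCardinalFiltered_iff_mathlib (J : Type v) [SmallCategory J] (κ : Cardinal.{v})
    [Fact κ.IsRegular] :
    _root_.IsCardinalFiltered J κ ↔ CategoryTheory.IsCardinalFiltered J κ :=
  ⟨fun h ↦ ⟨fun F hA ↦ h _ (by rwa [hasCardinalLT_iff_cardinal_mk_lt] at hA) F⟩,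
    fun h K _ hK F ↦ h.nonempty_cocone F (by rwa [hasCardinalLT_iff_cardinal_mk_lt])⟩

lemma isPresentable_iff_isCardinalPresentable {𝒜 : Type u} [Category.{v} 𝒜]
    (κ : Cardinal.{v}) [Fact κ.IsRegular] (x : 𝒜) :
    IsPresentable κ x ↔ IsCardinalPresentable x κ :=
  ⟨fun h ↦ ⟨fun J _ hJ ↦ (h J ((isCardinalFiltered_iff_mathlib J κ).2 hJ)).some⟩,
    fun _ J _ hJ ↦
      have := (isCardinalFiltered_iff_mathlib J κ).1 hJ
      ⟨preservesColimitsOfShape_of_isCardinalPresentable x κ J⟩⟩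

namespace CategoryTheory.Adjunction

variable {𝒜 : Type u} [Category.{v} 𝒜] [Abelian 𝒜] {R : Type v} [Ring R]
  {F : ModuleCat.{v} R ⥤ 𝒜} {G : 𝒜 ⥤ ModuleCat.{v} R} (adj : F ⊣ G)

section

variable [PreservesFiniteLimits F] [IsIso adj.counit] {a : 𝒜}

/-- The morphism to `a` corresponding to a submodule of `G.obj a`. -/
def subobjectHom (N : Submodule R (G.obj a)) : F.obj (ModuleCat.of R N) ⟶ a :=
  F.map (ModuleCat.ofHom N.subtype) ≫ adj.counit.app a

instance (N : Submodule R (G.obj a)) : Mono (adj.subobjectHom N) := by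
  have : Mono (ModuleCat.ofHom N.subtype) :=
    (ModuleCat.mono_iff_injective _).2 N.injective_subtype
  unfold subobjectHom
  infer_instance

/-- The subobject of `a` corresponding to a submodule of `G.obj a`. -/
noncomputable def subobject (N : Submodule R (G.obj a)) : Subobject a :=
  Subobject.mk (adj.subobjectHom N)

lemma subobject_mono : Monotone (adj.subobject (a := a)) := fun N N' h ↦ by
  refine Subobject.mk_le_mk_of_comm (F.map (ModuleCat.ofHom (Submodule.inclusion h))) ?_
  rw [subobjectHom, ← Functor.map_comp_assoc]
  rfl

/-- A `κ`-presentable subobject of `a` is contained in one that corresponds to a submodule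
of `G.obj a` of cardinality `< κ`. -/
lemma exists_le_subobject {κ : Cardinal.{v}} [Fact κ.IsRegular] (hκ : Cardinal.aleph0 < κ)
    (hR : HasCardinalLT R κ) (x : Subobject a) [IsCardinalPresentable (x : 𝒜) κ] :
    ∃ N : Submodule R (G.obj a), HasCardinalLT N κ ∧ x ≤ adj.subobject N := by
  have := adj.leftAdjoint_preservesColimits
  have := ModuleCat.isCardinalFiltered_smallSubmodule (G.obj (x : 𝒜)) κ hκ hR
  obtain ⟨hc⟩ := ModuleCat.nonempty_isColimit_smallSubmoduleCocone (G.obj (x : 𝒜)) κ hκ hR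
  have := preservesColimitsOfShape_of_isCardinalPresentable (x : 𝒜) κ
    (ModuleCat.SmallSubmodule (G.obj (x : 𝒜)) κ)
  obtain ⟨N, p, hp⟩ := exists_hom_of_preservesColimit_coyoneda (isColimitOfPreserves F hc)
    (X := (x : 𝒜)) ((asIso adj.counit).inv.app (x : 𝒜))
  change (x : 𝒜) ⟶ F.obj (ModuleCat.of R N.1) at p
  replace hp : p ≫ F.map (ModuleCat.ofHom N.1.subtype) =
    (asIso adj.counit).inv.app (x : 𝒜) := hp
  let g := (G.map x.arrow).hom
  refine ⟨N.1.map g, N.2.of_surjective (g.submoduleMap N.1) (g.submoduleMap_surjective N.1),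
    Subobject.le_mk_of_comm (p ≫ F.map (ModuleCat.ofHom (g.submoduleMap N.1))) ?_⟩
  have hg : ModuleCat.ofHom (g.submoduleMap N.1) ≫ ModuleCat.ofHom (N.1.map g).subtype =
    ModuleCat.ofHom N.1.subtype ≫ G.map x.arrow := rfl
  rw [subobjectHom, Category.assoc, ← F.map_comp_assoc, hg, F.map_comp, Category.assoc,
    adj.counit_naturality, reassoc_of% hp]
  exact (asIso adj.counit).inv_hom_id_app_assoc _ _

lemma eq_top_of_subobject_span_le (b : Subobject a)
    (hb : ∀ y : G.obj a, adj.subobject (Submodule.span R {y}) ≤ b) : b = ⊤ := by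
  have : G.Full := adj.fullyFaithfulROfIsIsoCounit.full
  have : G.Faithful := adj.fullyFaithfulROfIsIsoCounit.faithful
  have := adj.rightAdjoint_preservesLimits
  have : Epi (G.map b.arrow) := by
    refine (ModuleCat.epi_iff_surjective _).2 fun y ↦ ?_
    let N := Submodule.span R {y}
    let q : F.obj (ModuleCat.of R N) ⟶ b :=
      Subobject.ofMkLE (adj.subobjectHom N) b (hb y)
    have hq : q ≫ b.arrow = adj.subobjectHom N := Subobject.ofMkLE_arrow _
    have h : adj.homEquiv _ _ q ≫ G.map b.arrow = ModuleCat.ofHom N.subtype := by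
      rw [← adj.homEquiv_naturality_right, hq]
      apply (adj.homEquiv _ _).symm.injective
      rw [Equiv.symm_apply_apply, adj.homEquiv_counit]
      rfl
    exact ⟨_, ConcreteCategory.congr_hom h ⟨y, Submodule.mem_span_singleton_self y⟩⟩
  have : IsIso (G.map b.arrow) := isIso_of_mono_of_epi _
  have : IsIso b.arrow := isIso_of_reflects_iso _ G
  exact Subobject.eq_top_of_isIso_arrow b

end

lemma isCardinalPresentable_subobject [F.Additive] [PreservesFiniteLimits F] [IsIso adj.counit]
    {a : 𝒜} {κ : Cardinal.{v}} [Fact κ.IsRegular] (hR : HasCardinalLT R κ)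
    (N : Submodule R (G.obj a)) (hN : HasCardinalLT N κ) :
    IsCardinalPresentable (adj.subobject N : 𝒜) κ := by
  have := adj.isCardinalAccessible_of_isIso_counit hR (κ := κ)
  have := ModuleCat.isCardinalPresentable_of_hasCardinalLT hR (.of R N) hN
  have := adj.isCardinalPresentable_leftAdjoint_obj κ (.of R N)
  exact isCardinalPresentable_of_iso (Subobject.underlyingIso (adj.subobjectHom N)).symm κ

end CategoryTheory.Adjunction

/-- Let `𝒜` be a Grothendieck abelian category, `R` a ring, `F ⊣ G` an adjoint pair of
additive functors with `F` exact and counit an isomorphism (Gabriel–Popescu), let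
`μ ≥ |R|` be infinite and `ν = μ⁺` its successor. Then for every regular cardinal
`λ ≥ ν` and every object `a` of `𝒜`: the poset of `λ`-presentable subobjects of `a` is
`λ`-filtered (every subset of cardinality `< λ` has an upper bound among `λ`-presentable
subobjects), and `a` is the supremum of its `λ`-presentable subobjects (every upper
bound of this family of subobjects is all of `a`). -/
theorem stmt_3 {𝒜 : Type u} [Category.{v} 𝒜] [Abelian 𝒜] [HasColimits 𝒜] [AB5 𝒜]
    [HasSeparator 𝒜]
    (R : Type v) [Ring R]
    (F : ModuleCat.{v} R ⥤ 𝒜) (G : 𝒜 ⥤ ModuleCat.{v} R)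
    [F.Additive] [G.Additive]
    (adj : F ⊣ G)
    [PreservesFiniteLimits F] [PreservesFiniteColimits F]
    (hcounit : IsIso adj.counit)
    (μ : Cardinal.{v}) (hμ : Cardinal.aleph0 ≤ μ) (hR : Cardinal.mk R ≤ μ)
    (ν : Cardinal.{v}) (hν : ν = Order.succ μ)
    (lam : Cardinal.{v}) (hreg : lam.IsRegular) (hlam : ν ≤ lam)
    (a : 𝒜) :
    (∀ s : Set (Subobject a), (∀ x ∈ s, IsPresentable lam ((x : Subobject a) : 𝒜)) →
      Cardinal.mk (s : Set (Subobject a)) < Cardinal.lift.{u} lam →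
      ∃ m : Subobject a, IsPresentable lam (m : 𝒜) ∧ ∀ x ∈ s, x ≤ m) ∧
    (∀ b : Subobject a,
      (∀ x : Subobject a, IsPresentable lam (x : 𝒜) → x ≤ b) → b = ⊤) := by
  have hμlam : μ < lam := (Order.lt_succ μ).trans_le (hν ▸ hlam)
  have hκ : Cardinal.aleph0 < lam := hμ.trans_lt hμlam
  have hR' : HasCardinalLT R lam := by
    rw [hasCardinalLT_iff_cardinal_mk_lt]
    exact hR.trans_lt hμlam
  have : Fact lam.IsRegular := ⟨hreg⟩
  simp only [isPresentable_iff_isCardinalPresentable]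
  refine ⟨fun s hs hcard ↦ ?_, fun b hb ↦ ?_⟩
  · have hs' : HasCardinalLT s lam :=
      (hasCardinalLT_lift_iff.{_, _, u} _ _).1 ((hasCardinalLT_iff_cardinal_mk_lt _ _).2 hcard)
    have (x : s) := hs x.1 x.2
    choose N hN hxN using fun x : s ↦ adj.exists_le_subobject hκ hR' x.1
    refine ⟨adj.subobject (⨆ x, N x), adj.isCardinalPresentable_subobject hR' _ ?_,
      fun x hx ↦ (hxN ⟨x, hx⟩).trans (adj.subobject_mono (le_iSup N ⟨x, hx⟩))⟩
    exact ModuleCat.hasCardinalLT_iSup _ hκ hR' hs' N hN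
  · exact adj.eq_top_of_subobject_span_le b fun y ↦ hb _ <|
      adj.isCardinalPresentable_subobject hR' _ <|
        (hasCardinalLT_of_finite ({y} : Set (G.obj a)) lam hκ.le).span hκ hR'
end

section
/- Let 𝒜 be a Grothendieck abelian category, and fix a ring R together with an adjoint pair of additive functors F : Mod R → 𝒜 and G : 𝒜 → Mod R (F left adjoint to G) such that F is exact and the counit F ∘ G ≅ id is an isomorphism. Let μ be an infinite cardinal with μ ≥ |R| and let ν = μ⁺ be its successor cardinal. Then for every regular cardinal λ ≥ ν, an object x of 𝒜 is λ-presentable if and only if x is the target of an epimorphism from a coproduct of fewer than λ objects, each of which is ν-presentable. -/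
open CategoryTheory Limits Opposite

universe v u

section CardinalPresentable

variable {𝒜 : Type u} [Category.{v} 𝒜]

lemma isCardinalFiltered_iff_root (J : Type v) [SmallCategory J] (κ : Cardinal.{v})
    [Fact κ.IsRegular] :
    CategoryTheory.IsCardinalFiltered J κ ↔ _root_.IsCardinalFiltered J κ :=
  ⟨fun h _ _ hK F ↦ h.nonempty_cocone F ((hasCardinalLT_iff_cardinal_mk_lt _ _).2 hK),
    fun h ↦ ⟨fun F hA ↦ h _ ((hasCardinalLT_iff_cardinal_mk_lt _ _).1 hA) F⟩⟩

lemma isCardinalPresentable_iff_root (κ : Cardinal.{v}) [Fact κ.IsRegular] (x : 𝒜) :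
    IsCardinalPresentable x κ ↔ _root_.IsPresentable κ x := by
  refine ⟨fun h J _ hJ ↦ ?_, fun h ↦ ⟨fun J _ hJ ↦ ?_⟩⟩
  · have := (isCardinalFiltered_iff_root J κ).2 hJ
    exact ⟨preservesColimitsOfShape_of_isCardinalPresentable x κ J⟩
  · exact (h J ((isCardinalFiltered_iff_root J κ).1 hJ)).some

end CardinalPresentable

section Modules

variable {R : Type v} [Ring R] {κ : Cardinal.{v}}

lemma hasCardinalLT_finsupp {S : Type v} (hκ : Cardinal.aleph0 < κ) (hR : HasCardinalLT R κ)
    (hS : HasCardinalLT S κ) : HasCardinalLT (S →₀ R) κ := by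
  rw [hasCardinalLT_iff_cardinal_mk_lt] at *
  refine (Cardinal.mk_le_of_injective (Finsupp.graph_injective S R)).trans_lt ?_
  rcases finite_or_infinite (S × R) with h | h
  · exact (Cardinal.mk_lt_aleph0).trans hκ
  · rw [Cardinal.mk_finset_of_infinite, Cardinal.mk_prod, Cardinal.lift_id, Cardinal.lift_id]
    exact Cardinal.mul_lt_of_lt hκ.le hS hR

lemma hasCardinalLT_span {M : Type v} [AddCommGroup M] [Module R M] {S : Set M}
    (hκ : Cardinal.aleph0 < κ) (hR : HasCardinalLT R κ) (hS : HasCardinalLT S κ) :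
    HasCardinalLT (Submodule.span R S) κ := by
  have h := hasCardinalLT_finsupp hκ hR hS
  rw [← Subtype.range_coe (s := S), ← Finsupp.range_linearCombination]
  exact h.of_surjective _ (LinearMap.surjective_rangeRestrict _)

variable [Fact κ.IsRegular]

lemma ModuleCat.isCardinalPresentable_free {T : Type v} (hT : HasCardinalLT T κ) :
    IsCardinalPresentable ((ModuleCat.free R).obj T) κ := by
  have := hT.isCardinalPresentable
  have : (forget (ModuleCat.{v} R)).IsCardinalAccessible κ := ⟨fun J _ _ ↦ by
    have := isFiltered_of_isCardinalFiltered J κ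
    infer_instance⟩
  exact (ModuleCat.adj R).isCardinalPresentable_leftAdjoint_obj κ T

lemma ModuleCat.isCardinalPresentable_of_hasCardinalLT_s4 (hκ : Cardinal.aleph0 < κ)
    (hR : HasCardinalLT R κ) (M : ModuleCat.{v} R) (hM : HasCardinalLT M κ) :
    IsCardinalPresentable M κ := by
  let g : (ModuleCat.free R).obj M ⟶ M := ModuleCat.ofHom (Finsupp.linearCombination R id)
  let f : (ModuleCat.free R).obj (LinearMap.ker g.hom) ⟶ (ModuleCat.free R).obj M :=
    ModuleCat.ofHom (Finsupp.linearCombination R Subtype.val)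
  have hg : Function.Surjective g.hom := Finsupp.linearCombination_id_surjective R M
  have hfg : LinearMap.range f.hom = LinearMap.ker g.hom := by
    dsimp [f]
    exact (Finsupp.range_linearCombination R).trans
      (by rw [Subtype.range_coe]; exact Submodule.span_eq _)
  let S := ShortComplex.moduleCatMkOfKerLERange f g hfg.le
  have hS : S.Exact := ShortComplex.Exact.moduleCat_of_range_eq_ker _ _ hfg
  have : Epi S.g := (ModuleCat.epi_iff_surjective _).2 hg
  have hK : HasCardinalLT (LinearMap.ker g.hom) κ :=
    (hasCardinalLT_finsupp hκ hR hM).of_injective _ Subtype.val_injective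
  have (k : WalkingParallelPair) :
      IsCardinalPresentable ((parallelPair S.f 0).obj k) κ := by
    cases k
    · exact ModuleCat.isCardinalPresentable_free hK
    · exact ModuleCat.isCardinalPresentable_free hM
  exact isCardinalPresentable_of_isColimit _ hS.gIsCokernel κ
    (hasCardinalLT_of_finite _ _ hκ.le)

end Modules

section Localization

variable {𝒜 : Type u} [Category.{v} 𝒜] {R : Type v} [Ring R]
  {F : ModuleCat.{v} R ⥤ 𝒜} {G : 𝒜 ⥤ ModuleCat.{v} R} (adj : F ⊣ G) {κ : Cardinal.{v}}

variable (F κ) in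
/-- The morphisms between modules of cardinality `< κ` which are inverted by the functor `F`. -/
def smallInverted : MorphismProperty (ModuleCat.{v} R) :=
  fun X Y f ↦ HasCardinalLT X κ ∧ HasCardinalLT Y κ ∧ IsIso (F.map f)

include adj in
lemma isLocal_smallInverted_rightAdjoint_obj (A : 𝒜) : (smallInverted F κ).isLocal (G.obj A) := by
  rintro X Y f ⟨-, -, _⟩
  refine ⟨fun g₁ g₂ h ↦ ?_, fun g ↦ ?_⟩
  · apply (adj.homEquiv _ _).symm.injective
    rw [← cancel_epi (F.map f), ← adj.homEquiv_naturality_left_symm,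
      ← adj.homEquiv_naturality_left_symm]
    exact congrArg _ h
  · refine ⟨adj.homEquiv _ _ (inv (F.map f) ≫ (adj.homEquiv _ _).symm g), ?_⟩
    dsimp only
    rw [← adj.homEquiv_naturality_left]
    simp

variable [Abelian 𝒜] [F.Additive] [PreservesFiniteLimits F] [IsIso adj.counit]

include adj in
lemma isIso_unit_app_of_isLocal_smallInverted (hκ : Cardinal.aleph0 < κ) (hR : HasCardinalLT R κ)
    (N : ModuleCat.{v} R) (hN : (smallInverted F κ).isLocal N) : IsIso (adj.unit.app N) := by
  set η := adj.unit.app N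
  have hFη : IsIso (F.map η) := by
    have h : F.map η = inv (adj.counit.app (F.obj N)) :=
      IsIso.eq_inv_of_inv_hom_id (adj.left_triangle_components N)
    rw [h]
    infer_instance
  have hFηm : Mono (F.map η) := hFη.mono_of_iso
  have card {M : ModuleCat.{v} R} (m : M) :
      HasCardinalLT (ModuleCat.of R (Submodule.span R {m})) κ :=
    hasCardinalLT_span hκ hR (hasCardinalLT_of_finite _ _ hκ.le)
  have hmono : Mono η := by
    rw [ModuleCat.mono_iff_ker_eq_bot, LinearMap.ker_eq_bot']
    intro n hn
    let i : ModuleCat.of R (Submodule.span R {n}) ⟶ N :=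
      ModuleCat.ofHom (Submodule.span R {n}).subtype
    have : Mono i := (ModuleCat.mono_iff_injective _).2 Subtype.val_injective
    have hi : i ≫ η = 0 := by
      ext ⟨x, hx⟩
      obtain ⟨r, rfl⟩ := Submodule.mem_span_singleton.1 hx
      change η.hom (r • n) = 0
      rw [map_smul, hn, smul_zero]
    have hFi : F.map i = 0 := by
      rw [← cancel_mono (F.map η), ← F.map_comp, hi, F.map_zero, zero_comp]
    have hz : IsZero (F.obj (ModuleCat.of R (Submodule.span R {n}))) :=
      IsZero.of_mono_eq_zero _ hFi
    have hW : smallInverted F κ (0 : ModuleCat.of R (Submodule.span R {n}) ⟶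
        ModuleCat.of R (Submodule.span R {n})) :=
      ⟨card n, card n, ⟨0, hz.eq_of_src _ _, hz.eq_of_src _ _⟩⟩
    have hi0 : i = 0 := (hN _ hW).1 (by simp)
    exact congrArg (fun f ↦ f.hom (⟨n, Submodule.mem_span_singleton_self n⟩ :
      Submodule.span R {n})) hi0
  have hepi : Epi η := by
    rw [ModuleCat.epi_iff_surjective]
    intro g
    let i : ModuleCat.of R (Submodule.span R {g}) ⟶ G.obj (F.obj N) :=
      ModuleCat.ofHom (Submodule.span R {g}).subtype
    have hW : smallInverted F κ (pullback.snd η i) := by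
      refine ⟨(card g).of_injective _
        ((ModuleCat.mono_iff_injective (pullback.snd η i)).1 inferInstance), card g, ?_⟩
      exact ((IsPullback.of_hasPullback η i).map F).isIso_snd_of_isIso
    obtain ⟨h, hh⟩ := (hN _ hW).2 (pullback.fst η i)
    have : h ≫ η = i := by
      apply (isLocal_smallInverted_rightAdjoint_obj adj (F.obj N) _ hW).1
      dsimp only at hh ⊢
      rw [← Category.assoc, hh, pullback.condition]
    exact ⟨h.hom ⟨g, Submodule.mem_span_singleton_self g⟩,
      congrArg (fun f ↦ f.hom (⟨g, Submodule.mem_span_singleton_self g⟩ :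
        Submodule.span R {g})) this⟩
  exact isIso_of_mono_of_epi η

variable [Fact κ.IsRegular]

include adj in
lemma isCardinalAccessible_rightAdjoint (hκ : Cardinal.aleph0 < κ) (hR : HasCardinalLT R κ) :
    G.IsCardinalAccessible κ := by
  refine ⟨fun J _ _ ↦ ⟨fun {D} ↦ ?_⟩⟩
  have := (smallInverted F κ).isClosedUnderColimitsOfShape_isLocal J κ
    (fun X Y f hf ↦ ⟨X.isCardinalPresentable_of_hasCardinalLT_s4 hκ hR hf.1,
      Y.isCardinalPresentable_of_hasCardinalLT_s4 hκ hR hf.2.1⟩)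
  have hN : (smallInverted F κ).isLocal (colimit (D ⋙ G)) :=
    ObjectProperty.prop_colimit _ _
      (fun j ↦ isLocal_smallInverted_rightAdjoint_obj adj (D.obj j))
  have := isIso_unit_app_of_isLocal_smallInverted adj hκ hR _ hN
  have := adj.leftAdjoint_preservesColimits
  let e : D ≅ (D ⋙ G) ⋙ F :=
    D.rightUnitor.symm ≪≫ Functor.isoWhiskerLeft D (asIso adj.counit).symm
  let t : Cocone D := (Cocone.precompose e.hom).obj (F.mapCocone (colimit.cocone (D ⋙ G)))
  have ht : IsColimit t := (IsColimit.precomposeHomEquiv e _).symm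
    (isColimitOfPreserves F (colimit.isColimit (D ⋙ G)))
  refine preservesColimit_of_preserves_colimit_cocone ht
    (IsColimit.ofIsoColimit (colimit.isColimit (D ⋙ G))
      (Cocone.ext (asIso (adj.unit.app (colimit (D ⋙ G)))) (fun j ↦ ?_)))
  have h₁ := adj.unit.naturality (colimit.ι (D ⋙ G) j)
  have h₂ : adj.unit.app (G.obj (D.obj j)) = G.map (inv (adj.counit.app (D.obj j))) := by
    rw [← cancel_mono (G.map (adj.counit.app (D.obj j))), adj.right_triangle_components,
      ← G.map_comp, IsIso.inv_hom_id, G.map_id]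
    rfl
  have h₃ : t.ι.app j = inv (adj.counit.app (D.obj j)) ≫ F.map (colimit.ι (D ⋙ G) j) := by
    simp [t, e]
  change colimit.ι (D ⋙ G) j ≫ adj.unit.app (colimit (D ⋙ G)) = G.map (t.ι.app j)
  rw [h₃, G.map_comp, ← h₂]
  exact h₁

end Localization

section Generated

variable {𝒜 : Type u} [Category.{v} 𝒜] {R : Type v} [Ring R]

/-- The objects `x` for which there is a set of fewer than `κ` elements of `G.obj x` on which
morphisms from `x` are determined. -/
def isCardinalGenerated (G : 𝒜 ⥤ ModuleCat.{v} R) (κ : Cardinal.{v}) : ObjectProperty 𝒜 :=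
  fun x ↦ ∃ S : Set (G.obj x), HasCardinalLT S κ ∧
    ∀ ⦃y⦄ (f g : x ⟶ y), (∀ s ∈ S, (G.map f).hom s = (G.map g).hom s) → f = g

variable {F : ModuleCat.{v} R ⥤ 𝒜} {G : 𝒜 ⥤ ModuleCat.{v} R} {κ : Cardinal.{v}}

lemma isCardinalGenerated_of_jointly_epi [Fact κ.IsRegular] {J : Type v} (hJ : HasCardinalLT J κ)
    {x : 𝒜} (y : J → 𝒜) (hy : ∀ j, isCardinalGenerated G κ (y j)) (p : ∀ j, y j ⟶ x)
    (hp : ∀ ⦃z : 𝒜⦄ (f g : x ⟶ z), (∀ j, p j ≫ f = p j ≫ g) → f = g) :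
    isCardinalGenerated G κ x := by
  choose S hS hS' using hy
  refine ⟨⋃ j, (G.map (p j)).hom '' S j, hasCardinalLT_iUnion _ hJ fun j ↦
    (hS j).of_surjective (Set.imageFactorization _ _) Set.imageFactorization_surjective,
    fun z f g h ↦ hp f g fun j ↦ hS' j _ _ fun s hs ↦ ?_⟩
  simpa using h _ (Set.mem_iUnion_of_mem j (Set.mem_image_of_mem _ hs))

instance [Fact κ.IsRegular] : (isCardinalGenerated G κ).IsClosedUnderIsomorphisms where
  of_iso {x _} e hx := isCardinalGenerated_of_jointly_epi (J := PUnit)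
    (hasCardinalLT_of_finite _ _ (Fact.out : κ.IsRegular).aleph0_le) (fun _ ↦ x) (fun _ ↦ hx)
    (fun _ ↦ e.hom) (fun _ _ _ h ↦ (cancel_epi e.hom).1 (h ⟨⟩))

lemma isClosedUnderColimitsOfShape_isCardinalGenerated [Fact κ.IsRegular] {J : Type v}
    [SmallCategory J] (hJ : HasCardinalLT (Arrow J) κ) :
    (isCardinalGenerated G κ).IsClosedUnderColimitsOfShape J where
  colimitsOfShape_le := fun _ ⟨p⟩ ↦
    isCardinalGenerated_of_jointly_epi (hasCardinalLT_of_hasCardinalLT_arrow hJ) _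
      p.prop_diag_obj p.ι.app (fun _ _ _ h ↦ p.isColimit.hom_ext h)

/-- The morphism `F.obj R ⟶ x` corresponding to an element of `G.obj x`. -/
def freeHom (adj : F ⊣ G) {x : 𝒜} (s : G.obj x) : F.obj (ModuleCat.of R R) ⟶ x :=
  (adj.homEquiv _ _).symm (ModuleCat.ofHom (LinearMap.toSpanSingleton R (G.obj x) s))

lemma freeHom_comp (adj : F ⊣ G) {x y : 𝒜} (s : G.obj x) (f : x ⟶ y) :
    freeHom adj s ≫ f = freeHom adj ((G.map f).hom s) := by
  dsimp [freeHom]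
  rw [← adj.homEquiv_naturality_right_symm]
  congr 1
  ext
  simp

lemma freeHom_injective (adj : F ⊣ G) (x : 𝒜) :
    Function.Injective (freeHom adj : G.obj x → _) := fun s t h ↦ by
  simpa using congrArg (fun f ↦ f.hom (1 : R)) ((adj.homEquiv _ _).symm.injective h)

lemma freeHom_surjective (adj : F ⊣ G) (x : 𝒜) :
    Function.Surjective (freeHom adj : G.obj x → _) := fun f ↦
  ⟨(adj.homEquiv _ _ f).hom (1 : R), by
    rw [freeHom, Equiv.symm_apply_eq]
    ext
    simp⟩

lemma freeHom_comp_eq_iff (adj : F ⊣ G) {x y : 𝒜} (s : G.obj x) (f g : x ⟶ y) :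
    freeHom adj s ≫ f = freeHom adj s ≫ g ↔ (G.map f).hom s = (G.map g).hom s := by
  rw [freeHom_comp, freeHom_comp, (freeHom_injective adj y).eq_iff]

lemma isCardinalGenerated_obj (adj : F ⊣ G) (hκ : Cardinal.aleph0 ≤ κ) :
    isCardinalGenerated G κ (F.obj (ModuleCat.of R R)) := by
  obtain ⟨s, hs⟩ := freeHom_surjective adj _ (𝟙 (F.obj (ModuleCat.of R R)))
  refine ⟨{s}, hasCardinalLT_of_finite _ _ hκ, fun y f g h ↦ ?_⟩
  simpa [hs] using (freeHom_comp_eq_iff adj s f g).2 (h s rfl)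

lemma isStrongGenerator_singleton [Abelian 𝒜] (adj : F ⊣ G) [IsIso adj.counit] :
    (ObjectProperty.singleton (F.obj (ModuleCat.of R R))).IsStrongGenerator := by
  have hs : (ObjectProperty.singleton (F.obj (ModuleCat.of R R))).IsSeparating := by
    intro x y f g h
    have := adj.fullyFaithfulROfIsIsoCounit.faithful
    refine G.map_injective ?_
    ext s
    exact (freeHom_comp_eq_iff adj s f g).1 (h _ (by simp) _)
  rw [ObjectProperty.isStrongGenerator_iff]
  refine ⟨hs, fun x y i _ h ↦ ?_⟩
  have : Epi i := ⟨fun f g hfg ↦ hs _ _ fun z hz p ↦ by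
    obtain ⟨q, rfl⟩ := h z hz p
    simp [hfg]⟩
  exact isIso_of_mono_of_epi i

variable [Abelian 𝒜] (adj : F ⊣ G) [F.Additive] [PreservesFiniteLimits F] [IsIso adj.counit]
  [Fact κ.IsRegular]

include adj in
lemma isCardinalPresentable_obj (hκ : Cardinal.aleph0 < κ) (hR : HasCardinalLT R κ)
    (M : ModuleCat.{v} R) (hM : HasCardinalLT M κ) : IsCardinalPresentable (F.obj M) κ := by
  have := isCardinalAccessible_rightAdjoint adj hκ hR
  have := M.isCardinalPresentable_of_hasCardinalLT_s4 hκ hR hM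
  exact adj.isCardinalPresentable_leftAdjoint_obj κ M

include adj in
lemma isCardinalPresentable_of_isCardinalGenerated (hκ : Cardinal.aleph0 < κ)
    (hR : HasCardinalLT R κ) {x : 𝒜} (hx : isCardinalGenerated G κ x) :
    IsCardinalPresentable x κ := by
  obtain ⟨S, hS, hS'⟩ := hx
  let M := ModuleCat.of R (Submodule.span R S)
  let i : M ⟶ G.obj x := ModuleCat.ofHom (Submodule.span R S).subtype
  have : Mono i := (ModuleCat.mono_iff_injective _).2 Subtype.val_injective
  have : Mono (F.map i) := inferInstance
  let q : F.obj M ⟶ x := F.map i ≫ adj.counit.app x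
  have : Mono q := mono_comp _ _
  have : Epi q := by
    refine ⟨fun f g h ↦ hS' f g fun s hs ↦ ?_⟩
    let j : ModuleCat.of R R ⟶ M :=
      ModuleCat.ofHom (LinearMap.toSpanSingleton R M ⟨s, Submodule.subset_span hs⟩)
    have hj : j ≫ i = ModuleCat.ofHom (LinearMap.toSpanSingleton R (G.obj x) s) := by
      ext
      simp [i, j, M]
    have hs' : freeHom adj s = F.map j ≫ q := by
      rw [freeHom, ← hj, adj.homEquiv_naturality_left_symm, adj.homEquiv_counit]
    rw [← freeHom_comp_eq_iff adj, hs', Category.assoc _ q f, Category.assoc _ q g, h]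
  have : IsIso q := isIso_of_mono_of_epi _
  have := isCardinalPresentable_obj adj hκ hR M (hasCardinalLT_span hκ hR hS)
  exact isCardinalPresentable_of_iso (asIso q) κ

variable [HasColimits 𝒜]

include adj in
lemma isCardinalGenerated_iff_isCardinalPresentable (hκ : Cardinal.aleph0 < κ)
    (hR : HasCardinalLT R κ) (x : 𝒜) :
    isCardinalGenerated G κ x ↔ IsCardinalPresentable x κ := by
  refine ⟨isCardinalPresentable_of_isCardinalGenerated adj hκ hR, fun hx ↦ ?_⟩
  have hx : isCardinalPresentable 𝒜 κ x := hx
  rw [IsStrongGenerator.colimitsCardinalClosure_eq_isCardinalPresentable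
    (isStrongGenerator_singleton adj)
    (by rintro _ ⟨⟩; exact isCardinalPresentable_obj adj hκ hR _ hR)] at hx
  refine ObjectProperty.colimitsCardinalClosure_le _ κ
    (fun J _ hJ ↦ isClosedUnderColimitsOfShape_isCardinalGenerated hJ) ?_ x hx
  rintro _ ⟨⟩
  exact isCardinalGenerated_obj adj hκ.le

end Generated

/-- Let `𝒜` be a Grothendieck abelian category, `R` a ring, `F ⊣ G` an adjoint pair of
additive functors with `F` exact and counit an isomorphism (Gabriel–Popescu), let
`μ ≥ |R|` be infinite and `ν = μ⁺` its successor. Then for every regular cardinal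
`λ ≥ ν`, an object `x` of `𝒜` is `λ`-presentable if and only if it is the target of an
epimorphism from a coproduct of fewer than `λ` objects, each `ν`-presentable. -/
theorem stmt_4 {𝒜 : Type u} [Category.{v} 𝒜] [Abelian 𝒜] [HasColimits 𝒜] [AB5 𝒜]
    [HasSeparator 𝒜]
    (R : Type v) [Ring R]
    (F : ModuleCat.{v} R ⥤ 𝒜) (G : 𝒜 ⥤ ModuleCat.{v} R)
    [F.Additive] [G.Additive]
    (adj : F ⊣ G)
    [PreservesFiniteLimits F] [PreservesFiniteColimits F]
    (hcounit : IsIso adj.counit)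
    (μ : Cardinal.{v}) (hμ : Cardinal.aleph0 ≤ μ) (hR : Cardinal.mk R ≤ μ)
    (ν : Cardinal.{v}) (hν : ν = Order.succ μ)
    (lam : Cardinal.{v}) (hreg : lam.IsRegular) (hlam : ν ≤ lam)
    (x : 𝒜) :
    IsPresentable lam x ↔
      ∃ (α : Type v) (f : α → 𝒜) (c : (∐ f) ⟶ x),
        Cardinal.mk α < lam ∧ (∀ i, IsPresentable ν (f i)) ∧ Epi c := by
  subst hν
  have hν := Cardinal.isRegular_succ hμ
  have : Fact lam.IsRegular := ⟨hreg⟩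
  have : Fact (Order.succ μ).IsRegular := ⟨hν⟩
  have hRν : HasCardinalLT R (Order.succ μ) :=
    (hasCardinalLT_iff_cardinal_mk_lt _ _).2 (Order.lt_succ_of_le hR)
  have hν₀ : Cardinal.aleph0 < Order.succ μ := Order.lt_succ_of_le hμ
  simp_rw [← isCardinalPresentable_iff_root, ← hasCardinalLT_iff_cardinal_mk_lt]
  rw [← isCardinalGenerated_iff_isCardinalPresentable adj (hν₀.trans_le hlam) (hRν.of_le hlam)]
  constructor
  · rintro ⟨S, hS, hS'⟩
    refine ⟨S, fun _ ↦ F.obj (ModuleCat.of R R), Sigma.desc fun s ↦ freeHom adj s.1, hS,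
      fun _ ↦ isCardinalPresentable_obj adj hν₀ hRν _ hRν, ⟨fun f g h ↦ hS' f g fun s hs ↦ ?_⟩⟩
    rw [← freeHom_comp_eq_iff adj]
    simpa using Sigma.ι (fun _ : S ↦ F.obj (ModuleCat.of R R)) ⟨s, hs⟩ ≫= h
  · rintro ⟨α, f, c, hα, hf, _⟩
    refine isCardinalGenerated_of_jointly_epi hα f (fun i ↦ ?_) (fun i ↦ Sigma.ι f i ≫ c)
      (fun z p q h ↦ ?_)
    · rw [isCardinalGenerated_iff_isCardinalPresentable adj (hν₀.trans_le hlam) (hRν.of_le hlam)]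
      have := hf i
      exact isCardinalPresentable_of_le (f i) hlam
    · rw [← cancel_epi c]
      exact Sigma.hom_ext _ _ fun i ↦ by simpa using h i
end

section
/- Let k be a field of characteristic p > 0, let n ≥ 1, let T = k[x₁, …, xₙ]/(x₁ᵖ, …, xₙᵖ), and let S = k[x]/(xᵖ) viewed as a subring of T via x ↦ xₙ. Let B be a bounded complex of finitely generated T-modules on which xₙ acts as zero and whose cohomology is not identically zero. Then for infinitely many integers m ≥ 0 there exists a nonzero morphism B → Hom_S(T, k)[m] in the derived category D(T), where k is the S-module S/(x) and Hom_S(T, k) carries its natural T-module structure. -/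
open CategoryTheory Limits Opposite

universe w

noncomputable section

/-- The ring `T = k[x₁, …, xₙ]/(x₁ᵖ, …, xₙᵖ)`. -/
abbrev TRing (k : Type) [Field k] (p n : ℕ) : Type :=
  MvPolynomial (Fin n) k ⧸
    Ideal.span (Set.range fun i : Fin n => (MvPolynomial.X i : MvPolynomial (Fin n) k) ^ p)

/-- The ring `S = k[x]/(xᵖ)`. -/
abbrev SRing (k : Type) [Field k] (p : ℕ) : Type :=
  Polynomial k ⧸ Ideal.span {(Polynomial.X : Polynomial k) ^ p}

/-- The class of `x` in `S`. -/
abbrev xS (k : Type) [Field k] (p : ℕ) : SRing k p :=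
  Ideal.Quotient.mk _ Polynomial.X

/-- The class of `xᵢ` in `T`. -/
abbrev xT (k : Type) [Field k] (p n : ℕ) (i : Fin n) : TRing k p n :=
  Ideal.Quotient.mk _ (MvPolynomial.X i)

/-- The `S`-module `k = S/(x)`. -/
abbrev resField (k : Type) [Field k] (p : ℕ) : Type :=
  SRing k p ⧸ Ideal.span {xS k p}

section Rings

lemma MvPolynomial.mem_span_insert_X_pow {σ R : Type*} [CommSemiring R] {a b p : ℕ}
    (hab : a + b = p) (j : σ) (f : MvPolynomial σ R)
    (hf : X j ^ a * f ∈ Ideal.span (Set.range fun i : σ => (X i : MvPolynomial σ R) ^ p)) :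
    f ∈ Ideal.span
      (insert (X j ^ b) (Set.range fun i : σ => (X i : MvPolynomial σ R) ^ p)) := by
  have hI : (Set.range fun i : σ => (X i : MvPolynomial σ R) ^ p) =
      (fun s => monomial s (1 : R)) '' (Set.range fun i => Finsupp.single i p) := by
    rw [← Set.range_comp]
    simp [Function.comp_def, X_pow_eq_monomial]
  have hJ : insert (X j ^ b) (Set.range fun i : σ => (X i : MvPolynomial σ R) ^ p) =
      (fun s => monomial s (1 : R)) ''
        (insert (Finsupp.single j b) (Set.range fun i => Finsupp.single i p)) := by
    rw [Set.image_insert_eq, ← hI, X_pow_eq_monomial]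
  rw [hI, mem_ideal_span_monomial_image] at hf
  rw [hJ, mem_ideal_span_monomial_image]
  intro m hm
  obtain ⟨_, ⟨i, rfl⟩, hi⟩ := hf (Finsupp.single j a + m) (by
    rw [mem_support_iff] at hm ⊢
    rwa [X_pow_eq_monomial, coeff_monomial_mul, one_mul])
  rw [Finsupp.single_le_iff] at hi
  by_cases h : i = j
  · subst h
    refine ⟨_, Set.mem_insert _ _, ?_⟩
    rw [Finsupp.single_le_iff]
    simp only [Finsupp.coe_add, Pi.add_apply, Finsupp.single_eq_same] at hi
    omega
  · refine ⟨_, Set.mem_insert_of_mem _ ⟨i, rfl⟩, ?_⟩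
    rw [Finsupp.single_le_iff]
    simpa [Finsupp.single_apply, Ne.symm h] using hi

lemma xT_pow_self (k : Type) [Field k] (p n : ℕ) (j : Fin n) : xT k p n j ^ p = 0 := by
  rw [← map_pow, Ideal.Quotient.eq_zero_iff_mem]
  exact Ideal.subset_span ⟨j, rfl⟩

lemma exists_eq_xT_pow_mul (k : Type) [Field k] {a b p n : ℕ} (hab : a + b = p) (j : Fin n)
    (t : TRing k p n) (ht : xT k p n j ^ a * t = 0) : ∃ s, xT k p n j ^ b * s = t := by
  obtain ⟨f, rfl⟩ := Ideal.Quotient.mk_surjective t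
  rw [← map_pow, ← map_mul, Ideal.Quotient.eq_zero_iff_mem] at ht
  obtain ⟨c, z, hz, rfl⟩ :=
    Ideal.mem_span_insert.1 (MvPolynomial.mem_span_insert_X_pow hab j f ht)
  refine ⟨Ideal.Quotient.mk _ c, ?_⟩
  rw [map_add, Ideal.Quotient.eq_zero_iff_mem.2 hz, add_zero, map_mul, map_pow, mul_comm]

lemma exists_eq_algebraMap_add_mul_xS (k : Type) [Field k] (p : ℕ) (s : SRing k p) :
    ∃ (c : k) (s' : SRing k p), s = algebraMap k (SRing k p) c + s' * xS k p := by
  obtain ⟨f, rfl⟩ := Ideal.Quotient.mk_surjective s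
  refine ⟨f.coeff 0, Ideal.Quotient.mk _ f.divX, ?_⟩
  conv_lhs => rw [← Polynomial.divX_mul_X_add f]
  rw [map_add, map_mul, add_comm]
  rfl

lemma nontrivial_resField (k : Type) [Field k] {p : ℕ} (hp : 0 < p) :
    Nontrivial (resField k p) := by
  refine Ideal.Quotient.nontrivial_iff.2 fun h => ?_
  have hu : IsUnit (xS k p) := Ideal.span_singleton_eq_top.1 h
  have h0 : xS k p ^ p = 0 := by
    rw [← map_pow, Ideal.Quotient.eq_zero_iff_mem]
    exact Ideal.subset_span rfl
  have h1 : IsUnit (0 : SRing k p) := h0 ▸ hu.pow p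
  have h2 : (Ideal.Quotient.mk (Ideal.span {(Polynomial.X : Polynomial k) ^ p})) 1 = 0 := by
    rw [map_one]; exact (isUnit_zero_iff.1 h1).symm
  rw [Ideal.Quotient.eq_zero_iff_mem, Ideal.mem_span_singleton] at h2
  have h3 := (isUnit_pow_iff hp.ne').1 (isUnit_of_dvd_one h2)
  exact Polynomial.not_isUnit_X h3

lemma xS_smul_resField (k : Type) [Field k] (p : ℕ) (v : resField k p) : xS k p • v = 0 := by
  obtain ⟨s, rfl⟩ := Ideal.Quotient.mk_surjective v
  rw [← Ideal.Quotient.mk_eq_mk, ← Submodule.Quotient.mk_smul, Submodule.Quotient.mk_eq_zero]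
  exact Ideal.mul_mem_right _ _ (Ideal.subset_span rfl)

lemma LinearMap.exists_comp_eq_of_ker_le {K V W U : Type*} [Field K] [AddCommGroup V]
    [AddCommGroup W] [AddCommGroup U] [Module K V] [Module K W] [Module K U]
    (f : V →ₗ[K] W) (g : V →ₗ[K] U) (h : ker f ≤ ker g) : ∃ l : W →ₗ[K] U, l ∘ₗ f = g := by
  obtain ⟨l, hl⟩ := LinearMap.exists_extend
    ((ker f).liftQ g h ∘ₗ f.quotKerEquivRange.symm.toLinearMap)
  refine ⟨l, LinearMap.ext fun v => ?_⟩
  have := LinearMap.congr_fun hl (f.quotKerEquivRange (Submodule.Quotient.mk v))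
  simpa using this

end Rings

section DerivedCategory

universe v u

open DerivedCategory Pretriangulated

variable {C : Type u} [Category.{v} C] [Abelian C] [HasDerivedCategory.{w} C]

lemma Q_map_surjective_of_isKInjective (K L : CochainComplex C ℤ) [L.IsKInjective] :
    Function.Surjective (Q.map : (K ⟶ L) → (Q.obj K ⟶ Q.obj L)) := by
  intro f
  obtain ⟨g, hg⟩ := (CochainComplex.IsKInjective.Qh_map_bijective
    ((HomotopyCategory.quotient C _).obj K) L).surjective
    ((quotientCompQhIso C).hom.app K ≫ f ≫ (quotientCompQhIso C).inv.app L)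
  obtain ⟨g, rfl⟩ := (HomotopyCategory.quotient C _).map_surjective g
  refine ⟨g, ?_⟩
  rw [← cancel_epi ((quotientCompQhIso C).hom.app K), ← quotientCompQhIso_hom_naturality, hg]
  simp

instance isKInjective_single (E : C) [Injective E] (j : ℤ) :
    CochainComplex.IsKInjective ((HomologicalComplex.single C (ComplexShape.up ℤ) j).obj E) := by
  have (n : ℤ) : Injective
      (((HomologicalComplex.single C (ComplexShape.up ℤ) j).obj E).X n) := by
    by_cases h : n = j
    · exact Injective.of_iso (HomologicalComplex.singleObjXIsoOfEq _ j E n h).symm inferInstance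
    · exact (HomologicalComplex.isZero_single_obj_X _ j E n h).injective
  exact CochainComplex.isKInjective_of_injective _ j

/-- A dimension shift: when every map from `K` in degree `j` to the middle term of a short exact
sequence dies in the quotient, and the middle term is injective, the connecting homomorphism
is injective on maps from `K`. -/
lemma exists_ne_zero_of_shortExact {S : ShortComplex C} (hS : S.ShortExact) [Injective S.X₂]
    (K : CochainComplex C ℤ) (j : ℤ) (hK : ∀ g : K.X j ⟶ S.X₂, g ≫ S.g = 0)
    (h : ∃ f : Q.obj K ⟶ (singleFunctor C j).obj S.X₃, f ≠ 0) :
    ∃ f : Q.obj K ⟶ (singleFunctor C (j - 1)).obj S.X₁, f ≠ 0 := by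
  obtain ⟨f, hf⟩ := h
  have hS' := hS.map_of_exact (HomologicalComplex.single C (ComplexShape.up ℤ) j)
  let e : ((singleFunctor C j).obj S.X₁)⟦(1 : ℤ)⟧ ≅ (singleFunctor C (j - 1)).obj S.X₁ :=
    ((singleFunctors C).shiftIso 1 (j - 1) j (by ring)).app S.X₁
  let δ : (singleFunctor C j).obj S.X₃ ⟶ ((singleFunctor C j).obj S.X₁)⟦(1 : ℤ)⟧ :=
    triangleOfSESδ hS'
  refine ⟨f ≫ δ ≫ e.hom, fun h0 => hf ?_⟩
  have h1 : f ≫ δ = 0 := by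
    rw [← cancel_mono e.hom, Category.assoc, h0, zero_comp]
  obtain ⟨g, hg⟩ := Triangle.coyoneda_exact₃ _ (triangleOfSES_distinguished hS') f h1
  obtain ⟨g, rfl⟩ := Q_map_surjective_of_isKInjective K
    ((HomologicalComplex.single C (ComplexShape.up ℤ) j).obj S.X₂) g
  refine hg.trans ((Q.map_comp g _).symm.trans ((congrArg Q.map ?_).trans (Q.map_zero _ _)))
  change g ≫ (HomologicalComplex.single C (ComplexShape.up ℤ) j).map S.g = 0
  apply HomologicalComplex.to_single_hom_ext
  rw [HomologicalComplex.comp_f, HomologicalComplex.single_map_f_self, ← Category.assoc,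
    ← Category.assoc, Category.assoc (g.f j), Category.assoc (g.f j), ← Category.assoc,
    ← Category.assoc, hK, zero_comp]
  rfl

/-- A map out of the opcycles which does not vanish on homology gives a nonzero map to a single
complex in the derived category. -/
lemma exists_ne_zero_of_opcycles (K : CochainComplex C ℤ) (j : ℤ) {Y : C} (u : K.opcycles j ⟶ Y)
    (hu : K.homologyι j ≫ u ≠ 0) :
    ∃ f : Q.obj K ⟶ (singleFunctor C j).obj Y, f ≠ 0 := by
  let L := (HomologicalComplex.single C (ComplexShape.up ℤ) j).obj Y
  let g : K ⟶ L :=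
    HomologicalComplex.mkHomToSingle (K.pOpcycles j ≫ u) (by simp)
  refine ⟨Q.map g, fun h0 => hu ?_⟩
  have h1 : HomologicalComplex.homologyMap g j = 0 := by
    have := homologyFunctorFactors_hom_naturality g j
    rw [show Q.map g = (0 : Q.obj K ⟶ Q.obj L) from h0, Functor.map_zero, zero_comp] at this
    exact (cancel_epi ((homologyFunctorFactors C j).app K).hom).1 (this.symm.trans comp_zero.symm)
  have : IsIso (L.homologyπ j) := L.isIso_homologyπ (j - 1) j (by simp) rfl
  have h2 : HomologicalComplex.cyclesMap g j = 0 := by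
    rw [← cancel_mono (L.homologyπ j), ← HomologicalComplex.homologyπ_naturality, h1, comp_zero,
      zero_comp]
  have h3 := HomologicalComplex.cyclesMap_i g j
  rw [h2, zero_comp, HomologicalComplex.mkHomToSingle_f, ← Category.assoc, eq_comm] at h3
  have h4 := (cancel_mono _).1 (h3.trans zero_comp.symm)
  rw [← Category.assoc, ← HomologicalComplex.homology_π_ι, Category.assoc] at h4
  exact (cancel_epi _).1 (h4.trans comp_zero.symm)

end DerivedCategory

section Modules

universe v u

variable {R : Type u} [CommRing R]

/-- The sequence `0 ⟶ E[a] ⟶ E ⟶ E[b] ⟶ 0` whose second map is multiplication by `a`. -/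
def torsionBySequence (E : ModuleCat.{v} R) (a b : R) (h : ∀ e : E, b • a • e = 0) :
    ShortComplex (ModuleCat.{v} R) :=
  ShortComplex.mk (ModuleCat.ofHom (Submodule.torsionBy R E a).subtype)
    (ModuleCat.ofHom ((LinearMap.lsmul R E a).codRestrict (Submodule.torsionBy R E b) h))
    (by ext e; exact e.2)

lemma torsionBySequence_shortExact (E : ModuleCat.{v} R) (a b : R)
    (h : ∀ e : E, b • a • e = 0) (hex : ∀ e : E, b • e = 0 → ∃ e', a • e' = e) :
    (torsionBySequence E a b h).ShortExact where
  exact := by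
    rw [ShortComplex.moduleCat_exact_iff]
    intro e he
    exact ⟨⟨e, congrArg Subtype.val he⟩, rfl⟩
  mono_f := (ModuleCat.mono_iff_injective _).2 Subtype.val_injective
  epi_g := (ModuleCat.epi_iff_surjective _).2 fun e =>
    (hex e.1 e.2).imp fun _ h => Subtype.ext h

variable [HasDerivedCategory.{w} (ModuleCat.{v} R)]

open DerivedCategory

lemma exists_ne_zero_torsionBy (E : ModuleCat.{v} R) [Injective E] (a b : R)
    (h : ∀ e : E, b • a • e = 0) (hex : ∀ e : E, b • e = 0 → ∃ e', a • e' = e)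
    (K : CochainComplex (ModuleCat.{v} R) ℤ) (j : ℤ) (hK : ∀ m : K.X j, a • m = 0)
    (hf : ∃ f : Q.obj K ⟶ (singleFunctor (ModuleCat.{v} R) j).obj
      (ModuleCat.of R (Submodule.torsionBy R E b)), f ≠ 0) :
    ∃ f : Q.obj K ⟶ (singleFunctor (ModuleCat.{v} R) (j - 1)).obj
      (ModuleCat.of R (Submodule.torsionBy R E a)), f ≠ 0 := by
  have : Injective (torsionBySequence E a b h).X₂ := ‹Injective E›
  refine exists_ne_zero_of_shortExact (torsionBySequence_shortExact E a b h hex) K j ?_ hf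
  intro (g : K.X j ⟶ E)
  ext m
  refine Subtype.ext ?_
  change a • g m = 0
  rw [← map_smul, hK, map_zero]

lemma exists_ne_zero_torsionBy_sub_two_mul (E : ModuleCat.{v} R) [Injective E] (a b : R)
    (hab : a * b = 0) (hdvd : a ∣ b)
    (ha : ∀ e : E, a • e = 0 → ∃ e', b • e' = e) (hb : ∀ e : E, b • e = 0 → ∃ e', a • e' = e)
    (K : CochainComplex (ModuleCat.{v} R) ℤ) (hK : ∀ (j : ℤ) (m : K.X j), a • m = 0) (j : ℤ)
    (hf : ∃ f : Q.obj K ⟶ (singleFunctor (ModuleCat.{v} R) j).obj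
      (ModuleCat.of R (Submodule.torsionBy R E a)), f ≠ 0) (r : ℕ) :
    ∃ f : Q.obj K ⟶ (singleFunctor (ModuleCat.{v} R) (j - 2 * r)).obj
      (ModuleCat.of R (Submodule.torsionBy R E a)), f ≠ 0 := by
  induction r with
  | zero => rwa [Nat.cast_zero, mul_zero, sub_zero]
  | succ r ih =>
    have h1 := exists_ne_zero_torsionBy E b a (fun e => by rw [← mul_smul, hab, zero_smul]) ha K _
      (fun m => by
        obtain ⟨c, rfl⟩ := hdvd
        rw [mul_comm a c, mul_smul, hK, smul_zero]) ih
    have h2 := exists_ne_zero_torsionBy E a b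
      (fun e => by rw [← mul_smul, mul_comm, hab, zero_smul]) hb K _ (hK _) h1
    have hj : j - 2 * (r : ℤ) - 1 - 1 = j - 2 * ((r + 1 : ℕ) : ℤ) := by push_cast; ring
    rwa [hj] at h2

/-- The `a`-torsion of a coextension of scalars from a field receives a nonzero map from every
complex killed by `a` with nonzero homology. -/
lemma exists_ne_zero_torsionBy_coextendScalars {k : Type u} [Field k]
    {T : Type u} [CommRing T] [HasDerivedCategory.{w} (ModuleCat.{u} T)] (ψ : k →+* T)
    (V : ModuleCat.{u} k) [Nontrivial V] (a : T)
    (K : CochainComplex (ModuleCat.{u} T) ℤ) (j : ℤ) (hK : ∀ m : K.X j, a • m = 0)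
    (hj : ¬ IsZero (K.homology j)) :
    ∃ f : Q.obj K ⟶ (singleFunctor (ModuleCat.{u} T) j).obj
      (ModuleCat.of T (Submodule.torsionBy T ((ModuleCat.coextendScalars ψ).obj V) a)),
      f ≠ 0 := by
  obtain ⟨h, hh⟩ : ∃ h : K.homology j, h ≠ 0 := by
    by_contra! hc
    exact hj (ModuleCat.isZero_of_iff_subsingleton.2 ⟨fun x y => by rw [hc x, hc y]⟩)
  have hι : K.homologyι j h ≠ 0 := fun h0 => hh
    ((ModuleCat.mono_iff_injective (K.homologyι j)).1 inferInstance (h0.trans (map_zero _).symm))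
  have hO : ∀ m : K.opcycles j, a • m = 0 := fun m => by
    obtain ⟨m, rfl⟩ := (ModuleCat.epi_iff_surjective (K.pOpcycles j)).1 inferInstance m
    rw [← map_smul, hK, map_zero]
  obtain ⟨v, hv⟩ := exists_ne (0 : V)
  let M := (ModuleCat.restrictScalars ψ).obj (K.opcycles j)
  let y : M := K.homologyι j h
  obtain ⟨l, hl⟩ : ∃ l : Module.Dual k M, l y ≠ 0 := by
    by_contra! hc
    exact hι ((Module.forall_dual_apply_eq_zero_iff k (V := M) y).1 hc)
  let g : K.opcycles j ⟶ (ModuleCat.coextendScalars ψ).obj V :=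
    ModuleCat.RestrictionCoextensionAdj.HomEquiv.fromRestriction ψ
      (ModuleCat.ofHom (X := M) ((LinearMap.toSpanSingleton k V v) ∘ₗ l))
  refine exists_ne_zero_of_opcycles K j (ModuleCat.ofHom (g.hom.codRestrict _ fun m => ?_)) ?_
  · change a • g m = 0
    rw [← map_smul, hO, map_zero]
  · intro h0
    have h1 : g (K.homologyι j h) = 0 :=
      congrArg Subtype.val (ConcreteCategory.congr_hom h0 h)
    have h2 : l ((1 : T) • K.homologyι j h : K.opcycles j) • v = 0 :=
      congrArg (fun e => ModuleCat.CoextendScalars.equiv ψ V e (1 : T)) h1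
    rw [one_smul] at h2
    exact (smul_ne_zero hl hv) h2

instance injective_coextendScalars {k : Type u} [Field k] {T : Type u} [CommRing T] (ψ : k →+* T)
    (V : ModuleCat.{u} k) : Injective ((ModuleCat.coextendScalars ψ).obj V) := by
  have := Module.injective_of_isSemisimpleRing k V
  have : Injective V := Module.injective_object_of_injective_module k V
  exact Injective.injective_of_adjoint (ModuleCat.restrictCoextendScalarsAdj ψ) V

lemma exists_smul_eq_coextendScalars {k : Type u} [Field k] {T : Type u} [CommRing T]
    (ψ : k →+* T) (V : ModuleCat.{u} k) (a b : T)
    (hab : ∀ t, a * t = 0 → ∃ s, b * s = t) (e : (ModuleCat.coextendScalars ψ).obj V)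
    (he : b • e = 0) : ∃ e' : (ModuleCat.coextendScalars ψ).obj V, a • e' = e := by
  let M := (ModuleCat.restrictScalars ψ).obj (ModuleCat.of T T)
  let μ : M →ₗ[k] M :=
    ((ModuleCat.restrictScalars ψ).map (ModuleCat.ofHom (LinearMap.lsmul T T a))).hom
  let e₀ : M →ₗ[k] V := ModuleCat.CoextendScalars.equiv ψ V e
  obtain ⟨l, hl⟩ := LinearMap.exists_comp_eq_of_ker_le μ e₀ (fun t ht => by
    obtain ⟨s, rfl⟩ := hab t ht
    have : e₀ (s * b : T) = 0 := LinearMap.congr_fun he s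
    rwa [mul_comm] at this)
  refine ⟨(ModuleCat.CoextendScalars.equiv ψ V).symm l, ?_⟩
  refine ModuleCat.CoextendScalars.ext (LinearMap.ext fun (t : T) => ?_)
  have : l (a * t : T) = e₀ t := LinearMap.congr_fun hl t
  rwa [mul_comm] at this

/-- If `S` is generated by a field `k` and an element `x` killing `V`, then `Hom_S(T, V)` is the
`φ x`-torsion of `Hom_k(T, V)`. -/
def coextendScalarsEquivTorsionBy {k S T V : Type u} [Field k] [CommRing S] [CommRing T]
    [Algebra k S] [AddCommGroup V] [Module k V] [Module S V] [IsScalarTower k S V]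
    (φ : S →+* T) (x : S) (hx : ∀ v : V, x • v = 0)
    (hS : ∀ s : S, ∃ (c : k) (s' : S), s = algebraMap k S c + s' * x) :
    (ModuleCat.coextendScalars φ).obj (ModuleCat.of S V) ≃ₗ[T]
      Submodule.torsionBy T
        ((ModuleCat.coextendScalars (φ.comp (algebraMap k S))).obj (ModuleCat.of k V)) (φ x) where
  toFun f :=
    let f₀ : (ModuleCat.restrictScalars φ).obj (ModuleCat.of T T) →ₗ[S] V :=
      ModuleCat.CoextendScalars.equiv φ (ModuleCat.of S V) f
    ⟨(ModuleCat.CoextendScalars.equiv _ (ModuleCat.of k V)).symm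
      { toFun := fun t => f₀ t
        map_add' := fun t t' => f₀.map_add t t'
        map_smul' := fun c t =>
          (f₀.map_smul (algebraMap k S c) t).trans (algebraMap_smul S c (f₀ t)) },
      ModuleCat.CoextendScalars.ext (LinearMap.ext fun (t : T) => by
        change f₀ (t * φ x : T) = 0
        rw [mul_comm]
        exact (f₀.map_smul x t).trans (hx _))⟩
  map_add' _ _ := rfl
  map_smul' _ _ := rfl
  invFun f :=
    let f₀ : (ModuleCat.restrictScalars (φ.comp (algebraMap k S))).obj (ModuleCat.of T T) →ₗ[k] V :=
      ModuleCat.CoextendScalars.equiv _ (ModuleCat.of k V) f.1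
    (ModuleCat.CoextendScalars.equiv φ (ModuleCat.of S V)).symm
      { toFun := fun t => f₀ t
        map_add' := fun t t' => f₀.map_add t t'
        map_smul' := fun s (t : T) => by
          have hf (t : T) : f₀ (t * φ x : T) = 0 :=
            congrArg (fun e => ModuleCat.CoextendScalars.equiv _ (ModuleCat.of k V) e t) f.2
          obtain ⟨c, s', rfl⟩ := hS s
          have h1 : f₀ (φ (algebraMap k S c) * t : T) = c • f₀ t := f₀.map_smul c t
          have h2 : φ (algebraMap k S c + s' * x) * t =
              φ (algebraMap k S c) * t + φ s' * t * φ x := by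
            rw [map_add, map_mul]; ring
          change f₀ (φ (algebraMap k S c + s' * x) * t : T) =
            (algebraMap k S c + s' * x) • f₀ t
          rw [h2, add_smul, mul_smul, hx, smul_zero, add_zero, algebraMap_smul, ← h1]
          exact (f₀.map_add _ _).trans (by rw [hf, add_zero]) }
  left_inv _ := rfl
  right_inv _ := rfl

end Modules

/-- Let `k` be a field of characteristic `p > 0`, `n ≥ 1`,
`T = k[x₁, …, xₙ]/(x₁ᵖ, …, xₙᵖ)` and `S = k[x]/(xᵖ)`, viewed as a subring of `T` via the
ring homomorphism `φ` sending `x` to `xₙ`. Let `B` be a bounded complex of finitely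
generated `T`-modules on which `xₙ` acts as zero and whose cohomology is not identically
zero. Then for infinitely many integers `m ≥ 0` there is a nonzero morphism
`B ⟶ Hom_S(T, k)[m]` in the derived category `D(T)`, where `k` is the `S`-module
`S/(x)` and `Hom_S(T, k)` carries its natural `T`-module structure (the coextension of
scalars of `k` along `φ`). -/
theorem stmt_9 (k : Type) [Field k] (p : ℕ) (hp : 0 < p) [CharP k p]
    (n : ℕ) (hn : 1 ≤ n)
    (φ : SRing k p →+* TRing k p n)
    (hφ : φ (xS k p) = xT k p n ⟨n - 1, Nat.sub_lt hn Nat.one_pos⟩)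
    [HasDerivedCategory.{w} (ModuleCat (TRing k p n))]
    (B : CochainComplex (ModuleCat (TRing k p n)) ℤ)
    (hbdd : ∃ a b : ℤ, ∀ i : ℤ, (i < a ∨ b < i) → IsZero (B.X i))
    (hfg : ∀ i : ℤ, Module.Finite (TRing k p n) (B.X i))
    (hxn : ∀ (i : ℤ) (m : B.X i), xT k p n ⟨n - 1, Nat.sub_lt hn Nat.one_pos⟩ • m = 0)
    (hB : ∃ i : ℤ, ¬ IsZero (B.homology i)) :
    {m : ℕ | ∃ f : DerivedCategory.Q.obj B ⟶
        (((DerivedCategory.singleFunctor (ModuleCat (TRing k p n)) 0).obj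
          ((ModuleCat.coextendScalars φ).obj
            (ModuleCat.of (SRing k p) (resField k p))))⟦(m : ℤ)⟧),
      f ≠ 0}.Infinite := by
  have hp' : p.Prime := (CharP.char_is_prime_or_zero k p).resolve_right hp.ne'
  have h1 : 1 + (p - 1) = p := by omega
  set a := xT k p n ⟨n - 1, Nat.sub_lt hn Nat.one_pos⟩ with ha
  let V := resField k p
  have : Nontrivial (ModuleCat.of k V) := nontrivial_resField k hp
  let E := (ModuleCat.coextendScalars (φ.comp (algebraMap k (SRing k p)))).obj (ModuleCat.of k V)
  let e : (ModuleCat.coextendScalars φ).obj (ModuleCat.of (SRing k p) V) ≅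
      ModuleCat.of (TRing k p n) (Submodule.torsionBy (TRing k p n) E a) :=
    LinearEquiv.toModuleIso (hφ ▸ coextendScalarsEquivTorsionBy φ (xS k p)
      (xS_smul_resField k p) (exists_eq_algebraMap_add_mul_xS k p))
  obtain ⟨i, hi⟩ := hB
  refine Set.infinite_of_forall_exists_gt fun N => ⟨(2 * (N + 1 + i.natAbs : ℕ) - i : ℤ).toNat, ?_,
    by omega⟩
  have hm : (((2 * (N + 1 + i.natAbs : ℕ) - i : ℤ).toNat : ℕ) : ℤ) =
      2 * (N + 1 + i.natAbs : ℕ) - i := Int.toNat_of_nonneg (by omega)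
  obtain ⟨f, hf⟩ := exists_ne_zero_torsionBy_sub_two_mul E a (a ^ (p - 1))
    (by rw [← pow_succ', Nat.sub_add_cancel hp, ha, xT_pow_self])
    (dvd_pow_self a (Nat.sub_ne_zero_of_lt hp'.one_lt))
    (exists_smul_eq_coextendScalars _ _ _ _ fun t ht =>
      (exists_eq_xT_pow_mul k (Nat.sub_add_cancel hp) _ t ht).imp fun s hs => by rwa [pow_one] at hs)
    (exists_smul_eq_coextendScalars _ _ _ _ fun t ht =>
      exists_eq_xT_pow_mul k h1 _ t (by rwa [pow_one]))
    B hxn i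
    (exists_ne_zero_torsionBy_coextendScalars _ _ a B i (hxn i) hi) (N + 1 + i.natAbs)
  let s := ((DerivedCategory.singleFunctors (ModuleCat (TRing k p n))).shiftIso
    (((2 * (N + 1 + i.natAbs : ℕ) - i : ℤ).toNat : ℕ) : ℤ) (i - 2 * (N + 1 + i.natAbs : ℕ)) 0
    (by rw [hm]; ring)).app
      ((ModuleCat.coextendScalars φ).obj (ModuleCat.of (SRing k p) V))
  refine ⟨f ≫ (DerivedCategory.singleFunctor _ _).map e.inv ≫ s.inv, fun h0 => hf ?_⟩
  rw [← Category.assoc] at h0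
  have h2 := (cancel_mono s.inv).1 (h0.trans zero_comp.symm)
  exact (cancel_mono ((DerivedCategory.singleFunctor _ _).map e.inv)).1 (h2.trans zero_comp.symm)

end
end
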